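/- arXiv:2210.14965 — 2 statements merged into one kernel-verified Lean document; each statement's English description precedes it below -/
import Mathlib

section
/- Let X = (X_1, ..., X_n) be a centered Gaussian random vector in ℝⁿ (i.e., every linear functional ⟨u, X⟩ is a centered, possibly degenerate, Gaussian real random variable), let g_1, ..., g_n be fixed real numbers, and set σ² = max_{1 ≤ i ≤ n} E[X_i²], assumed strictly positive. Let M = max_{1 ≤ i ≤ n} |X_i + g_i|. Then for every t ≥ 0, P(|M − E[M]| ≥ t) ≤ 2·exp(−t²/(2σ²)). -/
open MeasureTheory ProbabilityTheory

namespace BTIS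

set_option linter.unusedSectionVars false

section abstract_part

variable {E ι : Type*} [NormedAddCommGroup E] [NormedSpace ℝ E] [MeasurableSpace E]
  [BorelSpace E] [SecondCountableTopology E] [CompleteSpace E] [Fintype ι]

structure Cls (l : ι → E →L[ℝ] ℝ) (lam K : ℝ) (f : E → ℝ) (q : E → ι → ℝ) : Prop where
  meas : ∀ j, Measurable (fun x => q x j)
  nonneg : ∀ x j, 0 ≤ q x j
  sum_one : ∀ x, ∑ j, q x j = 1
  lip : ∀ x y, |f (x + y) - f x| ≤ |lam| * ‖y‖
  taylor : ∀ x y, |f (x + y) - f x - lam * ∑ j, q x j * l j y| ≤ K * ‖y‖ ^ 2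

theorem Cls.continuous {l : ι → E →L[ℝ] ℝ} {lam K : ℝ} {f : E → ℝ} {q : E → ι → ℝ}
    (h : Cls l lam K f q) : Continuous f := by
  have : LipschitzWith (Real.toNNReal |lam|) f := by
    apply LipschitzWith.of_dist_le_mul
    intro x y
    have := h.lip y (x - y)
    rw [Real.dist_eq, dist_eq_norm, Real.coe_toNNReal _ (abs_nonneg _)]
    simpa using this
  exact this.continuous

theorem exp_taylor (w : ℝ) : Real.exp w ≤ 1 + w + w ^ 2 / 2 + |w| ^ 3 * Real.exp |w| := by
  have h := Complex.norm_exp_sub_sum_le_norm_mul_exp (w : ℂ) 3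
  have e : Complex.exp (w : ℂ) - ∑ m ∈ Finset.range 3, (w : ℂ) ^ m / (m.factorial : ℂ)
      = ((Real.exp w - (1 + w + w ^ 2 / 2) : ℝ) : ℂ) := by
    simp [Finset.sum_range_succ, Nat.factorial]
  rw [e, Complex.norm_real, Complex.norm_real, Real.norm_eq_abs, Real.norm_eq_abs] at h
  linarith [le_abs_self (Real.exp w - (1 + w + w ^ 2 / 2))]

theorem integrable_exp_norm (μ : Measure E) [IsGaussian μ] (a : ℝ) :
    Integrable (fun x => Real.exp (a * ‖x‖)) μ := by
  obtain ⟨C, hC, hi⟩ := IsGaussian.exists_integrable_exp_sq μ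
  refine (hi.const_mul (Real.exp (a ^ 2 / (4 * C)))).mono' (by fun_prop) ?_
  filter_upwards with x
  rw [Real.norm_eq_abs, abs_of_pos (Real.exp_pos _), ← Real.exp_add]
  apply Real.exp_le_exp.2
  have : a ^ 2 / (4 * C) + C * ‖x‖ ^ 2 - a * ‖x‖ = (a - 2 * C * ‖x‖) ^ 2 / (4 * C) := by
    field_simp; ring
  have h2 : 0 ≤ (a - 2 * C * ‖x‖) ^ 2 / (4 * C) := by positivity
  linarith

theorem integrable_norm' (μ : Measure E) [IsGaussian μ] : Integrable (fun x => ‖x‖) μ := by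
  refine (integrable_exp_norm μ 1).mono' (by fun_prop) ?_
  filter_upwards with x
  rw [norm_norm, one_mul]
  linarith [Real.add_one_le_exp ‖x‖]

theorem Cls.integrable {l : ι → E →L[ℝ] ℝ} {lam K : ℝ} {f : E → ℝ} {q : E → ι → ℝ}
    (h : Cls l lam K f q) (μ : Measure E) [IsGaussian μ] (x : E) (r : ℝ) :
    Integrable (fun v => f (x + r • v)) μ := by
  have hc := h.continuous
  refine ((integrable_const |f x|).add ((integrable_norm' μ).const_mul (|lam| * |r|))).mono'
    (by fun_prop) ?_
  filter_upwards with v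
  have h1 := h.lip x (r • v)
  rw [norm_smul, Real.norm_eq_abs] at h1
  have h2 := abs_sub_abs_le_abs_sub (f (x + r • v)) (f x)
  simp only [Real.norm_eq_abs, Pi.add_apply]
  linarith

theorem Cls.integrable_exp {l : ι → E →L[ℝ] ℝ} {lam K : ℝ} {f : E → ℝ} {q : E → ι → ℝ}
    (h : Cls l lam K f q) (μ : Measure E) [IsGaussian μ] (x : E) (r : ℝ) :
    Integrable (fun v => Real.exp (f (x + r • v))) μ := by
  have hc := h.continuous
  refine ((integrable_exp_norm μ (|lam| * |r|)).const_mul (Real.exp |f x|)).mono'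
    (by fun_prop) ?_
  filter_upwards with v
  have h1 := h.lip x (r • v)
  rw [norm_smul, Real.norm_eq_abs] at h1
  have h2 := abs_sub_abs_le_abs_sub (f (x + r • v)) (f x)
  have h3 := le_abs_self (f (x + r • v))
  rw [Real.norm_eq_abs, abs_of_pos (Real.exp_pos _), ← Real.exp_add]
  apply Real.exp_le_exp.2
  linarith

theorem step (l : ι → E →L[ℝ] ℝ) (hl : ∀ j y, |l j y| ≤ ‖y‖) (μ : Measure E) [IsGaussian μ]
    (σ2 : ℝ) (hσ : ∀ j, ∫ v, (l j v) ^ 2 ∂μ ≤ σ2) (lam K : ℝ) :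
    ∃ C : ℝ, ∀ r : ℝ, 0 ≤ r → r ≤ 1 → ∀ (f : E → ℝ) (q : E → ι → ℝ), Cls l lam K f q → ∀ x,
      ∫ v, Real.exp (f (x + r • v)) ∂μ ≤
        Real.exp (∫ v, f (x + r • v) ∂μ + (r ^ 2 * (lam ^ 2 * σ2 / 2) + r ^ 3 * C)) := by
  set G : E → ℝ := fun v => K * |lam| * ‖v‖ ^ 3 + |lam| ^ 3 * (‖v‖ ^ 3 * Real.exp (|lam| * ‖v‖))
    with hG
  have hcube : ∀ a : ℝ, 0 ≤ a → a ^ 3 ≤ 6 * Real.exp a := by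
    intro a ha
    have := Real.pow_div_factorial_le_exp a ha 3
    norm_num [Nat.factorial] at this
    linarith
  have hi1 : Integrable (fun v : E => ‖v‖ ^ 3) μ := by
    refine ((integrable_exp_norm μ 1).const_mul 6).mono' (by fun_prop) ?_
    filter_upwards with v
    rw [Real.norm_eq_abs, abs_of_nonneg (by positivity), one_mul]
    exact hcube _ (norm_nonneg _)
  have hi2 : Integrable (fun v : E => ‖v‖ ^ 3 * Real.exp (|lam| * ‖v‖)) μ := by
    refine ((integrable_exp_norm μ (1 + |lam|)).const_mul 6).mono' (by fun_prop) ?_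
    filter_upwards with v
    rw [Real.norm_eq_abs, abs_of_nonneg (by positivity), add_mul, one_mul, Real.exp_add, ← mul_assoc]
    gcongr
    exact hcube _ (norm_nonneg _)
  have hGi : Integrable G μ := (hi1.const_mul _).add (hi2.const_mul _)
  refine ⟨∫ v, G v ∂μ, ?_⟩
  intro r hr0 hr1 f q h x
  have hlsq : ∀ j, Integrable (fun v => (l j v) ^ 2) μ := fun j =>
    (IsGaussian.memLp_dual μ (l j) 2 (by simp)).integrable_sq
  have hWi : Integrable (fun v => f (x + r • v) - f x) μ :=
    (h.integrable μ x r).sub (integrable_const _)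
  have key : ∀ v, Real.exp (f (x + r • v) - f x) ≤
      1 + (f (x + r • v) - f x) + r ^ 2 * (lam ^ 2 / 2) * ∑ j, q x j * (l j v) ^ 2
        + r ^ 3 * G v := by
    intro v
    set W := f (x + r • v) - f x with hW
    set L := lam * ∑ j, q x j * l j v with hL
    have hWb : |W| ≤ r * (|lam| * ‖v‖) := by
      have := h.lip x (r • v)
      rw [norm_smul, Real.norm_eq_abs, abs_of_nonneg hr0] at this
      linarith
    have hLb : |L| ≤ |lam| * ‖v‖ := by
      rw [hL, abs_mul]
      gcongr
      calc |∑ j, q x j * l j v| ≤ ∑ j, |q x j * l j v| := Finset.abs_sum_le_sum_abs _ _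
        _ ≤ ∑ j, q x j * ‖v‖ := by
            apply Finset.sum_le_sum
            intro j _
            rw [abs_mul, abs_of_nonneg (h.nonneg x j)]
            exact mul_le_mul_of_nonneg_left (hl j v) (h.nonneg x j)
        _ = ‖v‖ := by rw [← Finset.sum_mul, h.sum_one, one_mul]
    have hT : |W - r * L| ≤ K * (r ^ 2 * ‖v‖ ^ 2) := by
      have := h.taylor x (r • v)
      rw [norm_smul, Real.norm_eq_abs, abs_of_nonneg hr0, mul_pow] at this
      have e : lam * ∑ j, q x j * l j (r • v) = r * L := by
        simp only [map_smul, smul_eq_mul, hL, Finset.mul_sum]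
        exact Finset.sum_congr rfl fun j _ => by ring
      rwa [e] at this
    have hL2 : L ^ 2 ≤ lam ^ 2 * ∑ j, q x j * (l j v) ^ 2 := by
      rw [hL, mul_pow]
      gcongr
      have := Finset.sum_mul_sq_le_sq_mul_sq Finset.univ (fun j => Real.sqrt (q x j))
        (fun j => Real.sqrt (q x j) * l j v)
      simp only [mul_pow, Real.sq_sqrt (h.nonneg x _), h.sum_one, one_mul, ← mul_assoc,
        Real.mul_self_sqrt (h.nonneg x _)] at this
      exact this
    have hW2 : W ^ 2 ≤ r ^ 2 * L ^ 2 + r ^ 3 * (2 * (K * |lam| * ‖v‖ ^ 3)) := by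
      have h1 : |W + r * L| ≤ 2 * r * (|lam| * ‖v‖) := by
        have : |r * L| ≤ r * (|lam| * ‖v‖) := by
          rw [abs_mul, abs_of_nonneg hr0]; gcongr
        linarith [abs_add_le W (r * L)]
      have h2 : (W - r * L) * (W + r * L) ≤
          K * (r ^ 2 * ‖v‖ ^ 2) * (2 * r * (|lam| * ‖v‖)) := by
        calc _ ≤ |(W - r * L) * (W + r * L)| := le_abs_self _
          _ = |W - r * L| * |W + r * L| := abs_mul _ _
          _ ≤ _ := mul_le_mul hT h1 (abs_nonneg _) ((abs_nonneg _).trans hT)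
      nlinarith [h2]
    have hW3 : |W| ^ 3 * Real.exp |W| ≤
        r ^ 3 * (|lam| ^ 3 * (‖v‖ ^ 3 * Real.exp (|lam| * ‖v‖))) := by
      have h1 : |W| ≤ |lam| * ‖v‖ :=
        hWb.trans (mul_le_of_le_one_left (by positivity) hr1)
      calc |W| ^ 3 * Real.exp |W| ≤ (r * (|lam| * ‖v‖)) ^ 3 * Real.exp (|lam| * ‖v‖) := by
            gcongr
        _ = _ := by ring
    have h4 := exp_taylor W
    have h5 : r ^ 2 * L ^ 2 ≤ r ^ 2 * (lam ^ 2 * ∑ j, q x j * (l j v) ^ 2) := by gcongr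
    simp only [hG]
    nlinarith
  have hSi : Integrable (fun v => ∑ j, q x j * (l j v) ^ 2) μ :=
    integrable_finsetSum _ fun j _ => (hlsq j).const_mul _
  have hS : ∫ v, ∑ j, q x j * (l j v) ^ 2 ∂μ ≤ σ2 := by
    rw [integral_finsetSum _ fun j _ => (hlsq j).const_mul _]
    simp only [integral_const_mul]
    calc ∑ j, q x j * ∫ v, (l j v) ^ 2 ∂μ ≤ ∑ j, q x j * σ2 :=
          Finset.sum_le_sum fun j _ => mul_le_mul_of_nonneg_left (hσ j) (h.nonneg x j)
      _ = σ2 := by rw [← Finset.sum_mul, h.sum_one, one_mul]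
  have hei : Integrable (fun v => Real.exp (f (x + r • v) - f x)) μ := by
    simp only [Real.exp_sub]
    exact (h.integrable_exp μ x r).div_const _
  have hmain : ∫ v, Real.exp (f (x + r • v) - f x) ∂μ ≤
      Real.exp (∫ v, f (x + r • v) ∂μ - f x + (r ^ 2 * (lam ^ 2 * σ2 / 2) + r ^ 3 * ∫ v, G v ∂μ)) := by
    have h1 := integral_mono hei ((((integrable_const 1).add hWi).add
      (hSi.const_mul (r ^ 2 * (lam ^ 2 / 2)))).add (hGi.const_mul (r ^ 3))) key
    have h2 : ∫ v, (1 + (f (x + r • v) - f x) + r ^ 2 * (lam ^ 2 / 2) * ∑ j, q x j * (l j v) ^ 2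
        + r ^ 3 * G v) ∂μ = 1 + (∫ v, f (x + r • v) ∂μ - f x)
          + r ^ 2 * (lam ^ 2 / 2) * ∫ v, ∑ j, q x j * (l j v) ^ 2 ∂μ + r ^ 3 * ∫ v, G v ∂μ := by
      have i1 : Integrable (fun v => 1 + (f (x + r • v) - f x)) μ := (integrable_const 1).add hWi
      have i2 : Integrable (fun v => r ^ 2 * (lam ^ 2 / 2) * ∑ j, q x j * (l j v) ^ 2) μ :=
        hSi.const_mul _
      have i3 : Integrable (fun v => 1 + (f (x + r • v) - f x)
        + r ^ 2 * (lam ^ 2 / 2) * ∑ j, q x j * (l j v) ^ 2) μ := i1.add i2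
      rw [integral_add i3 (hGi.const_mul _), integral_add i1 i2,
        integral_add (integrable_const 1) hWi,
        integral_sub (h.integrable μ x r) (integrable_const _), integral_const_mul,
        integral_const_mul]
      simp
    have h3 : r ^ 2 * (lam ^ 2 / 2) * ∫ v, ∑ j, q x j * (l j v) ^ 2 ∂μ
        ≤ r ^ 2 * (lam ^ 2 / 2) * σ2 := by gcongr
    refine (h1.trans (le_of_eq h2)).trans ?_
    refine le_trans ?_ (Real.add_one_le_exp _)
    linarith
  have e1 : ∫ v, Real.exp (f (x + r • v)) ∂μ
      = Real.exp (f x) * ∫ v, Real.exp (f (x + r • v) - f x) ∂μ := by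
    rw [← integral_const_mul]
    congr 1; ext v
    rw [← Real.exp_add]; congr 1; ring
  rw [e1]
  calc _ ≤ Real.exp (f x) * _ := mul_le_mul_of_nonneg_left hmain (Real.exp_pos _).le
    _ = _ := by rw [← Real.exp_add]; congr 1; ring

/-- averaging preserves the class -/
theorem Cls.avg {l : ι → E →L[ℝ] ℝ} {lam K : ℝ} {f : E → ℝ} {q : E → ι → ℝ}
    (h : Cls l lam K f q) (ν : Measure E) [IsGaussian ν] :
    Cls l lam K (fun x => ∫ w, f (x + w) ∂ν) (fun x j => ∫ w, q (x + w) j ∂ν) := by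
  have hfi : ∀ x, Integrable (fun w => f (x + w)) ν := fun x => by
    simpa using h.integrable ν x 1
  have hqle : ∀ x j, q x j ≤ 1 := fun x j => by
    rw [← h.sum_one x]
    exact Finset.single_le_sum (fun j _ => h.nonneg x j) (Finset.mem_univ j)
  have hqi : ∀ x j, Integrable (fun w => q (x + w) j) ν := fun x j => by
    refine (integrable_const (1 : ℝ)).mono'
      (((h.meas j).comp (measurable_const_add x)).aestronglyMeasurable) ?_
    filter_upwards with w
    rw [Real.norm_eq_abs, abs_of_nonneg (h.nonneg _ _)]
    exact hqle _ _
  have hnorm : ∀ (g : E → ℝ) (c : ℝ), (∀ w, |g w| ≤ c) → |∫ w, g w ∂ν| ≤ c := by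
    intro g c hg
    have := norm_integral_le_of_norm_le_const (μ := ν) (f := g) (C := c)
      (Filter.Eventually.of_forall hg)
    simpa using this
  refine ⟨?_, ?_, ?_, ?_, ?_⟩
  · intro j
    have : StronglyMeasurable (Function.uncurry fun x w : E => q (x + w) j) :=
      ((h.meas j).comp (measurable_fst.add measurable_snd)).stronglyMeasurable
    exact this.integral_prod_right.measurable
  · intro x j
    exact integral_nonneg fun w => h.nonneg _ _
  · intro x
    rw [← integral_finsetSum _ fun j _ => hqi x j]
    simp [h.sum_one]
  · intro x y
    rw [← integral_sub (hfi _) (hfi _)]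
    apply hnorm
    intro w
    have := h.lip (x + w) y
    rwa [add_right_comm] at this
  · intro x y
    have e : lam * ∑ j, (∫ w, q (x + w) j ∂ν) * l j y
        = ∫ w, lam * ∑ j, q (x + w) j * l j y ∂ν := by
      rw [integral_const_mul, integral_finsetSum _ fun j _ => (hqi x j).mul_const _]
      simp only [integral_mul_const]
    have i1 : Integrable (fun w => f (x + y + w) - f (x + w)) ν := (hfi _).sub (hfi _)
    rw [e, ← integral_sub (hfi _) (hfi _), ← integral_sub i1
      ((integrable_finsetSum _ fun j _ => (hqi x j).mul_const _).const_mul _)]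
    apply hnorm
    intro w
    have := h.taylor (x + w) y
    rwa [add_right_comm] at this

noncomputable def iter (ρ : Measure E) : ℕ → Measure E
  | 0 => Measure.dirac 0
  | k + 1 => Measure.conv ρ (iter ρ k)

instance iter_gauss (ρ : Measure E) [IsGaussian ρ] (k : ℕ) : IsGaussian (iter ρ k) := by
  induction k with
  | zero => unfold iter; infer_instance
  | succ k ih => unfold iter; infer_instance

theorem iter_bound {l : ι → E →L[ℝ] ℝ} {lam K : ℝ} (μ : Measure E) [IsGaussian μ] (r ε : ℝ)
    (ρ : Measure E) [IsGaussian ρ] (hρ : ρ = μ.map (fun v => r • v))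
    (hstep : ∀ (f : E → ℝ) (q : E → ι → ℝ), Cls l lam K f q → ∀ x,
      ∫ v, Real.exp (f (x + r • v)) ∂μ ≤ Real.exp (∫ v, f (x + r • v) ∂μ + ε)) (k : ℕ) :
    ∀ (f : E → ℝ) (q : E → ι → ℝ), Cls l lam K f q → ∀ x,
      ∫ v, Real.exp (f (x + v)) ∂(iter ρ k) ≤ Real.exp (∫ v, f (x + v) ∂(iter ρ k) + k * ε) := by
  induction k with
  | zero => intro f q h x; simp [iter]
  | succ k ih =>
    intro f q h x
    have hc := h.continuous
    have hi1 : Integrable (fun v => f (x + v)) (iter ρ (k + 1)) := by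
      simpa using h.integrable (iter ρ (k + 1)) x 1
    have hi2 : Integrable (fun v => Real.exp (f (x + v))) (iter ρ (k + 1)) := by
      simpa using h.integrable_exp (iter ρ (k + 1)) x 1
    have hF := h.avg (iter ρ k)
    have hFc := hF.continuous
    have hmap : ∀ g : E → ℝ, Continuous g → ∫ v, g v ∂ρ = ∫ v, g (r • v) ∂μ := by
      intro g hg
      rw [hρ, integral_map (by fun_prop) hg.aestronglyMeasurable]
    have hFc' : Continuous fun v => ∫ w, f (x + v + w) ∂(iter ρ k) :=
      hFc.comp (by fun_prop : Continuous fun v : E => x + v)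
    have e1 : ∫ v, f (x + v) ∂(iter ρ (k + 1)) =
        ∫ v, ∫ w, f (x + r • v + w) ∂(iter ρ k) ∂μ := by
      rw [iter] at hi1 ⊢
      rw [integral_conv hi1]
      simp only [← add_assoc]
      exact hmap _ hFc'
    have hi3 : Integrable (fun v => ∫ w, Real.exp (f (x + v + w)) ∂(iter ρ k)) ρ := by
      rw [iter] at hi2
      have := ((integrable_conv_iff hi2.aestronglyMeasurable).1 hi2)
      simpa [add_assoc, abs_of_pos (Real.exp_pos _)] using this.2
    have e2 : ∫ v, Real.exp (f (x + v)) ∂(iter ρ (k + 1)) =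
        ∫ v, ∫ w, Real.exp (f (x + v + w)) ∂(iter ρ k) ∂ρ := by
      rw [iter] at hi2 ⊢
      rw [integral_conv hi2]
      simp only [← add_assoc]
    have hi4 : Integrable (fun v => Real.exp (∫ w, f (x + v + w) ∂(iter ρ k) + k * ε)) ρ := by
      have := (hF.integrable_exp ρ x 1).mul_const (Real.exp (k * ε))
      simpa [Real.exp_add] using this
    rw [e1, e2]
    calc _ ≤ ∫ v, Real.exp (∫ w, f (x + v + w) ∂(iter ρ k) + k * ε) ∂ρ :=
          integral_mono hi3 hi4 fun v => ih f q h (x + v)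
      _ = Real.exp (k * ε) * ∫ v, Real.exp (∫ w, f (x + r • v + w) ∂(iter ρ k)) ∂μ := by
          rw [hmap _ (by fun_prop), ← integral_const_mul]
          simp only [Real.exp_add, mul_comm]
      _ ≤ Real.exp (k * ε) * Real.exp (∫ v, ∫ w, f (x + r • v + w) ∂(iter ρ k) ∂μ + ε) :=
          mul_le_mul_of_nonneg_left (hstep _ _ hF x) (Real.exp_pos _).le
      _ = _ := by rw [← Real.exp_add]; congr 1; push_cast; ring

theorem iter_charFunDual (ρ : Measure E) [IsGaussian ρ] (k : ℕ) (L : StrongDual ℝ E) :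
    charFunDual (iter ρ k) L = charFunDual ρ L ^ k := by
  induction k with
  | zero => simp [iter, charFunDual_dirac]
  | succ k ih => rw [iter, charFunDual_conv, ih, pow_succ']

theorem iter_eq (μ : Measure E) [IsGaussian μ] (h0 : ∀ L : StrongDual ℝ E, ∫ x, L x ∂μ = 0)
    (N : ℕ) (hN : 0 < N) (r : ℝ) (hr : N * r ^ 2 = 1) :
    iter (μ.map (r • ContinuousLinearMap.id ℝ E)) N = μ := by
  apply Measure.ext_of_charFunDual
  ext L
  have e : L.comp (r • ContinuousLinearMap.id ℝ E) = r • L := by ext; simp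
  rw [iter_charFunDual, charFunDual_map, e, IsGaussian.charFunDual_eq, IsGaussian.charFunDual_eq,
    ← Complex.exp_nat_mul]
  have hv : Var[(r • L : StrongDual ℝ E); μ] = r ^ 2 * Var[L; μ] := by
    have : ((r • L : StrongDual ℝ E) : E → ℝ) = fun x => r * L x := by ext; simp
    rw [this, variance_const_mul]
  have hm : ∀ L : StrongDual ℝ E, ∫ x, ((L x : ℝ) : ℂ) ∂μ = 0 := by
    intro L
    rw [integral_complex_ofReal, h0, Complex.ofReal_zero]
  have hr' : (N : ℂ) * (r : ℂ) ^ 2 = 1 := by exact_mod_cast hr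
  rw [hm, hm, hv]
  congr 1
  push_cast
  linear_combination (-(Var[L; μ] : ℂ) / 2) * hr'

theorem mgf_bound (l : ι → E →L[ℝ] ℝ) (hl : ∀ j y, |l j y| ≤ ‖y‖) (μ : Measure E) [IsGaussian μ]
    (h0 : ∀ L : StrongDual ℝ E, ∫ x, L x ∂μ = 0)
    (σ2 : ℝ) (hσ : ∀ j, ∫ v, (l j v) ^ 2 ∂μ ≤ σ2) (lam K : ℝ) (f : E → ℝ) (q : E → ι → ℝ)
    (h : Cls l lam K f q) :
    ∫ v, Real.exp (f v) ∂μ ≤ Real.exp (∫ v, f v ∂μ + lam ^ 2 * σ2 / 2) := by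
  obtain ⟨C, hC⟩ := step l hl μ σ2 hσ lam K
  have key : ∀ N : ℕ, ∫ v, Real.exp (f v) ∂μ ≤
      Real.exp (∫ v, f v ∂μ + (lam ^ 2 * σ2 / 2 + Real.sqrt (1 / ((N : ℝ) + 1)) * C)) := by
    intro N
    set r := Real.sqrt (1 / ((N : ℝ) + 1)) with hr
    have hr2 : r ^ 2 = 1 / ((N : ℝ) + 1) := Real.sq_sqrt (by positivity)
    have hr0 : 0 ≤ r := Real.sqrt_nonneg _
    have hNr : ((N + 1 : ℕ) : ℝ) * r ^ 2 = 1 := by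
      rw [hr2]; push_cast; field_simp
    have hr1 : r ≤ 1 := by
      rw [hr]
      apply Real.sqrt_le_one.mpr
      rw [div_le_one (by positivity)]
      have : (0 : ℝ) ≤ N := by positivity
      linarith
    have h1 := iter_bound (l := l) (lam := lam) (K := K) μ r _
      (μ.map (r • ContinuousLinearMap.id ℝ E)) rfl (hC r hr0 hr1) (N + 1) f q h 0
    rw [iter_eq μ h0 (N + 1) (by positivity) r hNr] at h1
    simp only [zero_add] at h1
    refine h1.trans (le_of_eq ?_)
    congr 2
    linear_combination (lam ^ 2 * σ2 / 2 + r * C) * hNr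
  have ht : Filter.Tendsto (fun N : ℕ => Real.exp (∫ v, f v ∂μ +
      (lam ^ 2 * σ2 / 2 + Real.sqrt (1 / ((N : ℝ) + 1)) * C))) Filter.atTop
      (nhds (Real.exp (∫ v, f v ∂μ + (lam ^ 2 * σ2 / 2 + Real.sqrt 0 * C)))) := by
    have := (tendsto_one_div_add_atTop_nhds_zero_nat (𝕜 := ℝ))
    exact (Real.continuous_exp.tendsto _).comp (tendsto_const_nhds.add (tendsto_const_nhds.add
      (((Real.continuous_sqrt.tendsto 0).comp this).mul_const C)))
  have := ge_of_tendsto' ht key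
  simpa using this

/-! ### soft maximum -/

noncomputable def smS (l : ι → E →L[ℝ] ℝ) (c : ι → ℝ) (β : ℝ) (x : E) : ℝ :=
  ∑ j, Real.exp (β * (l j x + c j))

noncomputable def smF (l : ι → E →L[ℝ] ℝ) (c : ι → ℝ) (β : ℝ) (x : E) : ℝ :=
  Real.log (smS l c β x) / β

noncomputable def smq (l : ι → E →L[ℝ] ℝ) (c : ι → ℝ) (β : ℝ) (x : E) (j : ι) : ℝ :=
  Real.exp (β * (l j x + c j)) / smS l c β x

theorem smS_pos [Nonempty ι] (l : ι → E →L[ℝ] ℝ) (c : ι → ℝ) (β : ℝ) (x : E) :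
    0 < smS l c β x :=
  Finset.sum_pos (fun _ _ => Real.exp_pos _) Finset.univ_nonempty

theorem sm_cls [Nonempty ι] (l : ι → E →L[ℝ] ℝ) (hl : ∀ j y, |l j y| ≤ ‖y‖) (c : ι → ℝ) (β : ℝ)
    (hβ : 0 < β) (lam : ℝ) :
    Cls l lam (|lam| * (2 * β)) (fun x => lam * smF l c β x) (smq l c β) := by
  have hSp := smS_pos l c β
  have hq0 : ∀ x j, 0 ≤ smq l c β x j := fun x j =>
    div_nonneg (Real.exp_pos _).le (hSp x).le
  have hq1 : ∀ x, ∑ j, smq l c β x j = 1 := fun x => by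
    simp only [smq]
    rw [← Finset.sum_div]
    exact div_self (hSp x).ne'
  have hSc : Continuous (smS l c β) := by unfold smS; fun_prop
  have hA : ∀ x y, smF l c β (x + y) - smF l c β x
      = Real.log (∑ j, smq l c β x j * Real.exp (β * l j y)) / β := by
    intro x y
    have : ∑ j, smq l c β x j * Real.exp (β * l j y) = smS l c β (x + y) / smS l c β x := by
      rw [smS, Finset.sum_div]
      refine Finset.sum_congr rfl fun j _ => ?_
      rw [smq, div_mul_eq_mul_div, ← Real.exp_add, map_add]
      congr 2; ring
    rw [this, Real.log_div (hSp _).ne' (hSp _).ne', smF, smF, sub_div]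
  have hApos : ∀ x y, 0 < ∑ j, smq l c β x j * Real.exp (β * l j y) := fun x y =>
    Finset.sum_pos (fun j _ => mul_pos (div_pos (Real.exp_pos _) (hSp x)) (Real.exp_pos _))
      Finset.univ_nonempty
  have hJ : ∀ x y, β * ∑ j, smq l c β x j * l j y
      ≤ Real.log (∑ j, smq l c β x j * Real.exp (β * l j y)) := by
    intro x y
    rw [Real.le_log_iff_exp_le (hApos x y)]
    have := convexOn_exp.map_sum_le (t := Finset.univ) (w := smq l c β x)
      (p := fun j => β * l j y) (fun j _ => hq0 x j) (hq1 x) (fun _ _ => Set.mem_univ _)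
    simp only [smul_eq_mul] at this
    refine le_trans (le_of_eq ?_) this
    rw [Finset.mul_sum]
    congr 1
    exact Finset.sum_congr rfl fun j _ => by ring
  have hm : ∀ x y, |∑ j, smq l c β x j * l j y| ≤ ‖y‖ := by
    intro x y
    calc |∑ j, smq l c β x j * l j y| ≤ ∑ j, |smq l c β x j * l j y| :=
          Finset.abs_sum_le_sum_abs _ _
      _ ≤ ∑ j, smq l c β x j * ‖y‖ := by
          apply Finset.sum_le_sum
          intro j _
          rw [abs_mul, abs_of_nonneg (hq0 x j)]
          exact mul_le_mul_of_nonneg_left (hl j y) (hq0 x j)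
      _ = ‖y‖ := by rw [← Finset.sum_mul, hq1, one_mul]
  have hup : ∀ x y, Real.log (∑ j, smq l c β x j * Real.exp (β * l j y)) ≤ β * ‖y‖ := by
    intro x y
    rw [Real.log_le_iff_le_exp (hApos x y)]
    calc _ ≤ ∑ j, smq l c β x j * Real.exp (β * ‖y‖) := by
          apply Finset.sum_le_sum
          intro j _
          apply mul_le_mul_of_nonneg_left _ (hq0 x j)
          apply Real.exp_le_exp.2
          exact mul_le_mul_of_nonneg_left ((le_abs_self _).trans (hl j y)) hβ.le
      _ = _ := by rw [← Finset.sum_mul, hq1, one_mul]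
  have hlip : ∀ x y, |smF l c β (x + y) - smF l c β x| ≤ ‖y‖ := by
    intro x y
    rw [hA, abs_le, le_div_iff₀ hβ, div_le_iff₀ hβ]
    have h1 := hJ x y
    have h2 := hup x y
    have h3 := (abs_le.1 (hm x y)).1
    constructor <;> nlinarith
  have htay : ∀ x y, |smF l c β (x + y) - smF l c β x - ∑ j, smq l c β x j * l j y|
      ≤ 2 * β * ‖y‖ ^ 2 := by
    intro x y
    by_cases hy : β * ‖y‖ ≤ 1
    · have hz : ∀ j, |β * l j y| ≤ β * ‖y‖ := fun j => by
        rw [abs_mul, abs_of_pos hβ]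
        exact mul_le_mul_of_nonneg_left (hl j y) hβ.le
      have h1 : Real.log (∑ j, smq l c β x j * Real.exp (β * l j y)) ≤
          β * ∑ j, smq l c β x j * l j y + (β * ‖y‖) ^ 2 := by
        have h2 := Real.log_le_sub_one_of_pos (hApos x y)
        have h3 : ∑ j, smq l c β x j * Real.exp (β * l j y) ≤
            ∑ j, smq l c β x j * (1 + β * l j y + (β * ‖y‖) ^ 2) := by
          apply Finset.sum_le_sum
          intro j _
          apply mul_le_mul_of_nonneg_left _ (hq0 x j)
          have h4 := Real.abs_exp_sub_one_sub_id_le ((hz j).trans hy)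
          have h5 := (abs_le.1 h4).2
          have h6 : (β * l j y) ^ 2 ≤ (β * ‖y‖) ^ 2 := sq_le_sq' (by linarith [(abs_le.1 (hz j)).1])
            (abs_le.1 (hz j)).2
          linarith
        have h7 : ∑ j, smq l c β x j * (1 + β * l j y + (β * ‖y‖) ^ 2) =
            1 + β * ∑ j, smq l c β x j * l j y + (β * ‖y‖) ^ 2 := by
          simp only [mul_add, Finset.sum_add_distrib, ← Finset.sum_mul, hq1, one_mul, mul_one,
            Finset.mul_sum]
          congr 2
          exact Finset.sum_congr rfl fun j _ => by ring
        linarith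
      have h2 := hJ x y
      rw [hA]
      have h3 : 0 ≤ β ^ 2 * ‖y‖ ^ 2 := by positivity
      rw [abs_le, le_sub_iff_add_le, sub_le_iff_le_add, le_div_iff₀ hβ, div_le_iff₀ hβ]
      constructor <;> nlinarith
    · push Not at hy
      have h1 := hlip x y
      have h2 := hm x y
      have h3 := abs_sub (smF l c β (x + y) - smF l c β x) (∑ j, smq l c β x j * l j y)
      have h4 : ‖y‖ ≤ β * ‖y‖ * ‖y‖ := by
        nlinarith [norm_nonneg y]
      nlinarith
  refine ⟨?_, hq0, hq1, ?_, ?_⟩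
  · intro j
    unfold smq
    have := hSc.measurable
    fun_prop
  · intro x y
    rw [← mul_sub, abs_mul]
    exact mul_le_mul_of_nonneg_left (hlip x y) (abs_nonneg _)
  · intro x y
    rw [← mul_sub, ← mul_sub, abs_mul, mul_assoc]
    exact mul_le_mul_of_nonneg_left (htay x y) (abs_nonneg _)

theorem sm_approx [Nonempty ι] (l : ι → E →L[ℝ] ℝ) (c : ι → ℝ) (β : ℝ) (hβ : 0 < β) (x : E) (m : ℝ)
    (h1 : ∀ j, l j x + c j ≤ m) (h2 : ∃ j, l j x + c j = m) :
    |smF l c β x - m| ≤ Real.log (Fintype.card ι) / β := by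
  obtain ⟨j, hj⟩ := h2
  have hc : (0 : ℝ) < Fintype.card ι := by exact_mod_cast Fintype.card_pos
  have hlow : β * m ≤ Real.log (smS l c β x) := by
    rw [Real.le_log_iff_exp_le (smS_pos l c β x), ← hj]
    exact Finset.single_le_sum (f := fun j => Real.exp (β * (l j x + c j)))
      (fun _ _ => (Real.exp_pos _).le) (Finset.mem_univ j)
  have hup : Real.log (smS l c β x) ≤ Real.log (Fintype.card ι) + β * m := by
    rw [Real.log_le_iff_le_exp (smS_pos l c β x), Real.exp_add, Real.exp_log hc]
    calc smS l c β x ≤ ∑ _j : ι, Real.exp (β * m) :=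
          Finset.sum_le_sum fun j _ => Real.exp_le_exp.2 (mul_le_mul_of_nonneg_left (h1 j) hβ.le)
      _ = _ := by simp
  have hlc : 0 ≤ Real.log (Fintype.card ι) := by linarith
  have e : smF l c β x - m = (Real.log (smS l c β x) - β * m) / β := by
    rw [smF]; field_simp
  rw [e, abs_div, abs_of_pos hβ]
  gcongr
  rw [abs_le]; constructor <;> linarith

theorem max_mgf [Nonempty ι] (l : ι → E →L[ℝ] ℝ) (hl : ∀ j y, |l j y| ≤ ‖y‖) (c : ι → ℝ)
    (μ : Measure E) [IsGaussian μ] (h0 : ∀ L : StrongDual ℝ E, ∫ x, L x ∂μ = 0)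
    (σ2 : ℝ) (hσ : ∀ j, ∫ v, (l j v) ^ 2 ∂μ ≤ σ2) (m : E → ℝ) (hm : Measurable m)
    (h1 : ∀ x j, l j x + c j ≤ m x) (h2 : ∀ x, ∃ j, l j x + c j = m x) :
    Integrable m μ ∧ ∀ lam : ℝ, Integrable (fun x => Real.exp (lam * m x)) μ ∧
      ∫ x, Real.exp (lam * m x) ∂μ ≤ Real.exp (lam * ∫ x, m x ∂μ + lam ^ 2 * σ2 / 2) := by
  set D := Real.log (Fintype.card ι) with hD
  have hap : ∀ β, 0 < β → ∀ x, |smF l c β x - m x| ≤ D / β := fun β hβ x =>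
    sm_approx l c β hβ x (m x) (h1 x) (h2 x)
  have hFi : ∀ β, 0 < β → Integrable (smF l c β) μ := fun β hβ => by
    simpa using (sm_cls l hl c β hβ 1).integrable μ 0 1
  have hei : ∀ lam β, 0 < β → Integrable (fun x => Real.exp (lam * smF l c β x)) μ :=
    fun lam β hβ => by
      simpa using (sm_cls l hl c β hβ lam).integrable_exp μ 0 1
  have hmi : Integrable m μ := by
    refine ((hFi 1 one_pos).norm.add (integrable_const (D / 1))).mono' hm.aestronglyMeasurable ?_
    filter_upwards with x
    have := hap 1 one_pos x
    have h3 := abs_sub_abs_le_abs_sub (m x) (smF l c 1 x)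
    rw [abs_sub_comm] at h3
    simp only [Real.norm_eq_abs, Pi.add_apply]
    linarith
  have hcmp : ∀ lam β, 0 < β → ∀ x, Real.exp (lam * m x) ≤
      Real.exp (|lam| * (D / β)) * Real.exp (lam * smF l c β x) := by
    intro lam β hβ x
    rw [← Real.exp_add]
    apply Real.exp_le_exp.2
    have h3 : lam * (m x - smF l c β x) ≤ |lam| * (D / β) := by
      calc _ ≤ |lam * (m x - smF l c β x)| := le_abs_self _
        _ = |lam| * |m x - smF l c β x| := abs_mul _ _
        _ ≤ _ := by
          rw [abs_sub_comm]
          exact mul_le_mul_of_nonneg_left (hap β hβ x) (abs_nonneg _)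
    linarith
  have hemi : ∀ lam, Integrable (fun x => Real.exp (lam * m x)) μ := by
    intro lam
    refine ((hei lam 1 one_pos).const_mul (Real.exp (|lam| * (D / 1)))).mono'
      (by fun_prop) ?_
    filter_upwards with x
    rw [Real.norm_eq_abs, abs_of_pos (Real.exp_pos _)]
    exact hcmp lam 1 one_pos x
  refine ⟨hmi, fun lam => ⟨hemi lam, ?_⟩⟩
  have key : ∀ N : ℕ, ∫ x, Real.exp (lam * m x) ∂μ ≤ Real.exp
      (2 * |lam| * D * (1 / ((N : ℝ) + 1)) + (lam * ∫ x, m x ∂μ + lam ^ 2 * σ2 / 2)) := by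
    intro N
    set β : ℝ := (N : ℝ) + 1 with hβd
    have hβ : 0 < β := by positivity
    have h3 := integral_mono (hemi lam) ((hei lam β hβ).const_mul _) (hcmp lam β hβ)
    rw [integral_const_mul] at h3
    have h4 := mgf_bound l hl μ h0 σ2 hσ lam _ _ _ (sm_cls l hl c β hβ lam)
    rw [integral_const_mul] at h4
    have h5 : |∫ x, smF l c β x ∂μ - ∫ x, m x ∂μ| ≤ D / β := by
      rw [← integral_sub (hFi β hβ) hmi]
      have := norm_integral_le_of_norm_le_const (μ := μ) (f := fun x => smF l c β x - m x)
        (C := D / β) (Filter.Eventually.of_forall (hap β hβ))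
      simpa using this
    have h6 : lam * (∫ x, smF l c β x ∂μ - ∫ x, m x ∂μ) ≤ |lam| * (D / β) := by
      calc _ ≤ |lam * (∫ x, smF l c β x ∂μ - ∫ x, m x ∂μ)| := le_abs_self _
        _ = |lam| * |∫ x, smF l c β x ∂μ - ∫ x, m x ∂μ| := abs_mul _ _
        _ ≤ _ := mul_le_mul_of_nonneg_left h5 (abs_nonneg _)
    refine h3.trans ((mul_le_mul_of_nonneg_left h4 (Real.exp_pos _).le).trans ?_)
    rw [← Real.exp_add]
    apply Real.exp_le_exp.2
    have h7 : 2 * |lam| * D * (1 / β) = |lam| * (D / β) + |lam| * (D / β) := by ring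
    linarith
  have ht : Filter.Tendsto (fun N : ℕ => Real.exp
      (2 * |lam| * D * (1 / ((N : ℝ) + 1)) + (lam * ∫ x, m x ∂μ + lam ^ 2 * σ2 / 2))) Filter.atTop
      (nhds (Real.exp (2 * |lam| * D * 0 + (lam * ∫ x, m x ∂μ + lam ^ 2 * σ2 / 2)))) :=
    (Real.continuous_exp.tendsto _).comp
      (((tendsto_one_div_add_atTop_nhds_zero_nat (𝕜 := ℝ)).const_mul _).add_const _)
  have := ge_of_tendsto' ht key
  simpa using this

theorem max_conc [Nonempty ι] (l : ι → E →L[ℝ] ℝ) (hl : ∀ j y, |l j y| ≤ ‖y‖) (c : ι → ℝ)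
    (μ : Measure E) [IsGaussian μ] (h0 : ∀ L : StrongDual ℝ E, ∫ x, L x ∂μ = 0)
    (σ2 : ℝ) (hσ0 : 0 ≤ σ2) (hσ : ∀ j, ∫ v, (l j v) ^ 2 ∂μ ≤ σ2) (m : E → ℝ) (hm : Measurable m)
    (h1 : ∀ x j, l j x + c j ≤ m x) (h2 : ∀ x, ∃ j, l j x + c j = m x) (t : ℝ) (ht : 0 ≤ t) :
    μ.real {x | t ≤ |m x - ∫ y, m y ∂μ|} ≤ 2 * Real.exp (-t ^ 2 / (2 * σ2)) := by
  obtain ⟨hmi, hb⟩ := max_mgf l hl c μ h0 σ2 hσ m hm h1 h2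
  set e := ∫ y, m y ∂μ with he
  have hsub : ∀ s : ℝ, s ^ 2 = 1 →
      HasSubgaussianMGF (fun x => s * (m x - e)) σ2.toNNReal μ := by
    intro s hs
    have e1 : ∀ u x, Real.exp (u * (s * (m x - e)))
        = Real.exp (-(u * s * e)) * Real.exp (u * s * m x) := by
      intro u x
      rw [← Real.exp_add]; congr 1; ring
    refine ⟨fun u => ?_, fun u => ?_⟩
    · simp only [e1]
      exact (hb (u * s)).1.const_mul _
    · simp only [mgf, e1]
      rw [integral_const_mul, Real.coe_toNNReal _ hσ0]
      refine (mul_le_mul_of_nonneg_left (hb (u * s)).2 (Real.exp_pos _).le).trans (le_of_eq ?_)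
      rw [← Real.exp_add]
      congr 1
      linear_combination (u ^ 2 * σ2 / 2) * hs
  have a1 := (hsub 1 (by norm_num)).measure_ge_le ht
  have a2 := (hsub (-1) (by norm_num)).measure_ge_le ht
  rw [Real.coe_toNNReal _ hσ0] at a1 a2
  have hset : {x | t ≤ |m x - e|} ⊆ {x | t ≤ 1 * (m x - e)} ∪ {x | t ≤ -1 * (m x - e)} := by
    intro x hx
    simp only [Set.mem_ofPred_eq, Set.mem_union] at hx ⊢
    rcases le_abs.1 hx with h | h
    · left; linarith
    · right; linarith
  calc _ ≤ _ := measureReal_mono hset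
    _ ≤ _ := measureReal_union_le _ _
    _ ≤ _ := by linarith

end abstract_part
end BTIS

open MeasureTheory ProbabilityTheory

theorem stmt0 {Ω : Type*} [MeasurableSpace Ω] (P : Measure Ω) [IsProbabilityMeasure P]
    {n : ℕ} (hn : 0 < n) (X : Ω → Fin n → ℝ) (g : Fin n → ℝ)
    (hmeas : ∀ i, Measurable (fun ω => X ω i))
    (hgauss : ∀ u : Fin n → ℝ, ∃ v : NNReal,
      P.map (fun ω => ∑ i, u i * X ω i) = gaussianReal 0 v)
    (σ2 : ℝ) (hσ2 : σ2 = ⨆ i, ∫ ω, (X ω i) ^ 2 ∂P) (hσ2pos : 0 < σ2)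
    (M : Ω → ℝ) (hM : ∀ ω, M ω = ⨆ i, |X ω i + g i|)
    (t : ℝ) (ht : 0 ≤ t) :
    (P {ω | t ≤ |M ω - ∫ ω', M ω' ∂P|}).toReal ≤ 2 * Real.exp (-t ^ 2 / (2 * σ2)) := by
  have hX : Measurable X := measurable_pi_iff.2 hmeas
  haveI : Nonempty (Fin n) := ⟨⟨0, hn⟩⟩
  set μ : Measure (Fin n → ℝ) := P.map X with hμ
  have hmapL : ∀ L : (Fin n → ℝ) →L[ℝ] ℝ, ∃ v : NNReal, μ.map L = gaussianReal 0 v := by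
    intro L
    obtain ⟨v, hv⟩ := hgauss (fun i => L (Pi.single i 1))
    refine ⟨v, ?_⟩
    rw [← hv, hμ, Measure.map_map (by fun_prop) hX]
    congr 1
    ext ω
    have := L.toLinearMap.pi_apply_eq_sum_univ (X ω)
    simp only [ContinuousLinearMap.coe_coe, smul_eq_mul] at this
    simp only [Function.comp_apply]
    rw [this]
    refine Finset.sum_congr rfl fun i _ => ?_
    rw [mul_comm]
    congr 2
    ext j
    simp [Pi.single_apply, eq_comm]
  haveI : IsGaussian μ := isGaussian_of_map_eq_gaussianReal fun L => ⟨0, hmapL L⟩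
  have h0 : ∀ L : StrongDual ℝ (Fin n → ℝ), ∫ x, L x ∂μ = 0 := by
    intro L
    obtain ⟨v, hv⟩ := hmapL L
    have h := integral_map (μ := μ) (φ := L) (by fun_prop) (f := fun x : ℝ => x) (by fun_prop)
    rw [hv, integral_id_gaussianReal] at h
    exact h.symm
  set s : Bool → ℝ := fun b => if b then 1 else -1 with hs
  have hs1 : ∀ b, |s b| = 1 := by intro b; cases b <;> simp [hs]
  have hs2 : ∀ b, s b ^ 2 = 1 := by intro b; cases b <;> simp [hs]
  set l : Fin n × Bool → (Fin n → ℝ) →L[ℝ] ℝ :=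
    fun j => s j.2 • ContinuousLinearMap.proj (R := ℝ) (φ := fun _ : Fin n => ℝ) j.1 with hldef
  have hlx : ∀ j x, l j x = s j.2 * x j.1 := by intro j x; simp [hldef]
  set m : (Fin n → ℝ) → ℝ := fun x => ⨆ i, |x i + g i| with hmdef
  have hm : Measurable m := by
    apply Measurable.iSup
    intro i
    fun_prop
  have hbd : ∀ x : Fin n → ℝ, BddAbove (Set.range fun i => |x i + g i|) := fun x =>
    (Set.finite_range _).bddAbove
  have hl : ∀ j y, |l j y| ≤ ‖y‖ := by
    intro j y
    rw [hlx, abs_mul, hs1, one_mul]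
    exact norm_le_pi_norm y j.1
  have hsum : ∀ (x : Fin n → ℝ) (j : Fin n × Bool),
      l j x + s j.2 * g j.1 = s j.2 * (x j.1 + g j.1) := by
    intro x j; rw [hlx]; ring
  have hσ : ∀ j, ∫ v, (l j v) ^ 2 ∂μ ≤ σ2 := by
    intro j
    simp only [hlx, mul_pow, hs2, one_mul]
    rw [hμ, integral_map hX.aemeasurable
      ((measurable_pi_apply j.1).pow_const 2).aestronglyMeasurable, hσ2]
    exact le_ciSup (f := fun i => ∫ ω, (X ω i) ^ 2 ∂P) (Set.finite_range _).bddAbove j.1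
  have h1 : ∀ x j, l j x + s j.2 * g j.1 ≤ m x := by
    intro x j
    rw [hsum]
    calc _ ≤ |s j.2 * (x j.1 + g j.1)| := le_abs_self _
      _ = |x j.1 + g j.1| := by rw [abs_mul, hs1, one_mul]
      _ ≤ _ := le_ciSup (hbd x) j.1
  have h2 : ∀ x, ∃ j, l j x + s j.2 * g j.1 = m x := by
    intro x
    obtain ⟨i, hi⟩ := exists_eq_ciSup_of_finite (f := fun i => |x i + g i|)
    rcases abs_cases (x i + g i) with ⟨h, _⟩ | ⟨h, _⟩
    · refine ⟨(i, true), ?_⟩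
      rw [hsum, hmdef]; simp only [← hi, h]; simp [hs]
    · refine ⟨(i, false), ?_⟩
      rw [hsum, hmdef]; simp only [← hi, h]; simp [hs]
  have hfin := BTIS.max_conc l hl (fun j => s j.2 * g j.1) μ h0 σ2 hσ2pos.le hσ m hm h1 h2 t ht
  have hMm : ∀ ω, M ω = m (X ω) := hM
  have e1 : ∫ y, m y ∂μ = ∫ ω, M ω ∂P := by
    rw [hμ, integral_map hX.aemeasurable hm.aestronglyMeasurable]
    simp only [hMm]
  rw [e1, Measure.real, hμ, Measure.map_apply hX (measurableSet_le (by fun_prop) (by fun_prop))]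
    at hfin
  simpa only [Set.preimage_ofPred_eq, ← hMm] using hfin
end

section
/- Let T > 0 and let (f_r)_{r ∈ [0,T]} be a stochastic process with almost surely continuous sample paths such that every finite-dimensional marginal (f_{r_1}, ..., f_{r_n}) is a centered Gaussian random vector, and let g : [0,T] → ℝ be a continuous deterministic function. Set σ = sup_{r ∈ [0,T]} (E[f_r²])^{1/2} and assume 0 < σ < ∞ and that Z = sup_{r ∈ [0,T]} |f_r + g(r)| is integrable. Then for every t ≥ 0, P(|Z − E[Z]| > t) ≤ 2·exp(−t²/(2σ²)). -/
open MeasureTheory ProbabilityTheory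
namespace GaussConc

structure Good {κ : Type*} [Fintype κ] (L C : ℝ) (G : (κ → ℝ) → ℝ) : Prop where
  lip : ∀ x y, |G x - G y| ≤ L * ‖x - y‖
  grad : ∃ w : (κ → ℝ) → κ → ℝ, Measurable w ∧ (∀ s, ∑ k, |w s k| ≤ L) ∧
    ∀ s h, |G (s + h) - G s - ∑ k, w s k * h k| ≤ C * ‖h‖ ^ 2

section
variable {κ : Type*} [Fintype κ] {L C : ℝ} {G : (κ → ℝ) → ℝ}

lemma Good.L_nonneg (hG : Good L C G) : 0 ≤ L := by
  obtain ⟨w, -, hw, -⟩ := hG.grad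
  exact (Finset.sum_nonneg fun k _ => abs_nonneg _).trans (hw 0)

lemma Good.C_mul_nonneg (hG : Good L C G) (h : κ → ℝ) : 0 ≤ C * ‖h‖ ^ 2 := by
  obtain ⟨w, -, -, hw⟩ := hG.grad
  exact (abs_nonneg _).trans (hw 0 h)

lemma Good.continuous (hG : Good L C G) : Continuous G := by
  have : LipschitzWith L.toNNReal G := by
    apply LipschitzWith.of_dist_le_mul
    intro x y
    rw [Real.coe_toNNReal _ hG.L_nonneg, Real.dist_eq, dist_eq_norm]
    exact hG.lip x y
  exact this.continuous

lemma Good.measurable (hG : Good L C G) : Measurable G := hG.continuous.measurable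

lemma Good.smul (hG : Good L C G) (a : ℝ) : Good (|a| * L) (|a| * C) (fun x => a * G x) := by
  obtain ⟨w, h1, h2, h3⟩ := hG.grad
  refine ⟨fun x y => ?_, fun s => a • w s, by fun_prop, fun s => ?_, fun s h => ?_⟩
  · rw [← mul_sub, abs_mul, mul_assoc]
    exact mul_le_mul_of_nonneg_left (hG.lip x y) (abs_nonneg a)
  · simp only [Pi.smul_apply, smul_eq_mul, abs_mul, ← Finset.mul_sum]
    exact mul_le_mul_of_nonneg_left (h2 s) (abs_nonneg a)
  · have : a * G (s + h) - a * G s - ∑ k, (a • w s) k * h k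
      = a * (G (s + h) - G s - ∑ k, w s k * h k) := by
      simp only [Pi.smul_apply, smul_eq_mul, mul_sub, Finset.mul_sum, mul_assoc]
    rw [this, abs_mul, mul_assoc]
    exact mul_le_mul_of_nonneg_left (h3 s h) (abs_nonneg a)

variable (μ : Measure (κ → ℝ))

lemma abs_integral_le_const [IsProbabilityMeasure μ] {H : (κ → ℝ) → ℝ} {c : ℝ}
    (h : ∀ y, |H y| ≤ c) : |∫ y, H y ∂μ| ≤ c := by
  have := norm_integral_le_of_norm_le_const (μ := μ) (f := H) (C := c) (.of_forall h)
  simpa using this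

lemma integrable_of_exp_bound (hexp : ∀ a : ℝ, Integrable (fun y => Real.exp (a * ‖y‖)) μ)
    {H : (κ → ℝ) → ℝ} (hH : Measurable H) (A a : ℝ) (h : ∀ y, |H y| ≤ A * Real.exp (a * ‖y‖)) :
    Integrable H μ :=
  ((hexp a).const_mul A).mono' hH.aestronglyMeasurable (.of_forall h)

lemma Good.integrable [IsProbabilityMeasure μ] (hexp : ∀ a : ℝ, Integrable (fun y => Real.exp (a * ‖y‖)) μ)
    (hG : Good L C G) (s : κ → ℝ) (r : ℝ) : Integrable (fun y => G (s + r • y)) μ := by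
  have hn : Integrable (fun y : κ → ℝ => ‖y‖) μ := by
    apply integrable_of_exp_bound μ hexp (by fun_prop) 1 1
    intro y
    rw [abs_of_nonneg (norm_nonneg y), one_mul, one_mul]
    linarith [Real.add_one_le_exp ‖y‖]
  have := hG.measurable
  refine ((integrable_const |G s|).add (hn.const_mul (L * |r|))).mono'
    (this.comp (by fun_prop)).aestronglyMeasurable (.of_forall fun y => ?_)
  have h := hG.lip (s + r • y) s
  rw [add_sub_cancel_left, norm_smul] at h
  have := abs_sub_abs_le_abs_sub (G (s + r • y)) (G s)
  simp only [Real.norm_eq_abs, Pi.add_apply] at *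
  linarith

lemma Good.integrable_exp [IsProbabilityMeasure μ] (hexp : ∀ a : ℝ, Integrable (fun y => Real.exp (a * ‖y‖)) μ)
    (hG : Good L C G) (s : κ → ℝ) (r : ℝ) : Integrable (fun y => Real.exp (G (s + r • y))) μ := by
  have := hG.measurable
  apply integrable_of_exp_bound μ hexp (by fun_prop) (Real.exp (G s)) (L * |r|)
  intro y
  rw [Real.abs_exp, ← Real.exp_add, Real.exp_le_exp]
  have h := hG.lip (s + r • y) s
  rw [add_sub_cancel_left, norm_smul] at h
  have := le_abs_self (G (s + r • y) - G s)
  simp only [Real.norm_eq_abs] at *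
  linarith

lemma Good.avg [IsProbabilityMeasure μ] (hexp : ∀ a : ℝ, Integrable (fun y => Real.exp (a * ‖y‖)) μ)
    (hG : Good L C G) (r : ℝ) : Good L C (fun s => ∫ y, G (s + r • y) ∂μ) := by
  obtain ⟨w, h1, h2, h3⟩ := hG.grad
  have hwb : ∀ s k, |w s k| ≤ L := fun s k =>
    (Finset.single_le_sum (f := fun k => |w s k|) (fun _ _ => abs_nonneg _) (Finset.mem_univ k)).trans (h2 s)
  have hwk : ∀ k, Measurable fun s => w s k := fun k => by fun_prop
  have hwint : ∀ s k, Integrable (fun y => w (s + r • y) k) μ := fun s k =>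
    (integrable_const L).mono' ((hwk k).comp (by fun_prop)).aestronglyMeasurable
      (.of_forall fun y => hwb _ k)
  have hintg := hG.integrable μ hexp
  refine ⟨fun x y => ?_, fun s k => ∫ y, w (s + r • y) k ∂μ, ?_, fun s => ?_, fun s h => ?_⟩
  · rw [← integral_sub (hintg _ _) (hintg _ _)]
    refine abs_integral_le_const μ fun z => ?_
    refine (hG.lip _ _).trans_eq ?_
    congr 2; abel
  · refine measurable_pi_lambda _ fun k => ?_
    have : Measurable (Function.uncurry fun (s y : κ → ℝ) => w (s + r • y) k) :=
      (hwk k).comp (by fun_prop)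
    exact (this.stronglyMeasurable.integral_prod_right).measurable
  · calc ∑ k, |∫ y, w (s + r • y) k ∂μ| ≤ ∑ k, ∫ y, |w (s + r • y) k| ∂μ :=
          Finset.sum_le_sum fun k _ => abs_integral_le_integral_abs
      _ = ∫ y, ∑ k, |w (s + r • y) k| ∂μ := (integral_finsetSum _ fun k _ => (hwint s k).abs).symm
      _ ≤ ∫ y, L ∂μ := integral_mono (integrable_finsetSum _ fun k _ => (hwint s k).abs)
          (integrable_const L) (fun y => h2 _)
      _ = L := by simp
  · have e1 : ∑ k, (∫ y, w (s + r • y) k ∂μ) * h k = ∫ y, ∑ k, w (s + r • y) k * h k ∂μ := by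
      rw [integral_finsetSum _ fun k _ => (hwint s k).mul_const _]
      simp only [integral_mul_const]
    have i1 : Integrable (fun y => G (s + h + r • y) - G (s + r • y)) μ :=
      (hintg _ _).sub (hintg _ _)
    have i2 : Integrable (fun y => ∑ k, w (s + r • y) k * h k) μ :=
      integrable_finsetSum _ fun k _ => (hwint s k).mul_const _
    rw [e1, ← integral_sub (hintg _ _) (hintg _ _), ← integral_sub i1 i2]
    refine abs_integral_le_const μ fun z => ?_
    have := h3 (s + r • z) h
    rw [add_right_comm] at this
    exact this


lemma exp_le_cubic (x : ℝ) : Real.exp x ≤ 1 + x + x ^ 2 / 2 + |x| ^ 3 * Real.exp |x| := by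
  have h := Complex.norm_exp_sub_sum_le_norm_mul_exp (x : ℂ) 3
  have h' : |Real.exp x - (1 + x + x ^ 2 / 2)| ≤ |x| ^ 3 * Real.exp |x| := by
    rw [Complex.norm_real, Real.norm_eq_abs] at h
    refine le_trans (le_of_eq ?_) h
    rw [← Real.norm_eq_abs, ← Complex.norm_real]
    simp [Finset.sum_range_succ]
  linarith [le_abs_self (Real.exp x - (1 + x + x ^ 2 / 2))]

lemma cube_le_exp {x : ℝ} (hx : 0 ≤ x) : x ^ 3 ≤ 6 * Real.exp x := by
  have := Real.pow_div_factorial_le_exp x hx 3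
  norm_num [Nat.factorial] at this
  linarith

lemma four_le_exp {x : ℝ} (hx : 0 ≤ x) : x ^ 4 ≤ 24 * Real.exp x := by
  have := Real.pow_div_factorial_le_exp x hx 4
  norm_num [Nat.factorial] at this
  linarith

lemma one_step [IsProbabilityMeasure μ]
    (hexp : ∀ a : ℝ, Integrable (fun y => Real.exp (a * ‖y‖)) μ)
    (v : ℝ) (hv : ∀ k, ∫ y, (y k) ^ 2 ∂μ ≤ v) (hv0 : 0 ≤ v) (hC : 0 ≤ C) :
    ∃ K, ∀ G : (κ → ℝ) → ℝ, Good L C G → ∀ s r, 0 ≤ r → r ≤ 1 →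
      ∫ y, Real.exp (G (s + r • y)) ∂μ ≤
        Real.exp (∫ y, G (s + r • y) ∂μ + r ^ 2 * (L ^ 2 * v / 2) + K * r ^ 3) := by
  set m1 := ∫ y, ‖y‖ ∂μ with hm1
  have hm1n : 0 ≤ m1 := integral_nonneg fun y => norm_nonneg y
  have hn : Integrable (fun y : κ → ℝ => ‖y‖) μ := by
    apply integrable_of_exp_bound μ hexp (by fun_prop) 1 1
    intro y
    rw [abs_of_nonneg (norm_nonneg y), one_mul, one_mul]
    linarith [Real.add_one_le_exp ‖y‖]
  have hy2 : ∀ k, Integrable (fun y : κ → ℝ => (y k) ^ 2) μ := by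
    intro k
    apply integrable_of_exp_bound μ hexp (by fun_prop) 2 1
    intro y
    have h1 : |y k| ≤ ‖y‖ := norm_le_pi_norm y k
    have h2 := Real.pow_div_factorial_le_exp ‖y‖ (norm_nonneg y) 2
    norm_num [Nat.factorial] at h2
    rw [abs_pow, one_mul]
    have := pow_le_pow_left₀ (abs_nonneg _) h1 2
    linarith
  set B := 12 * L * C + 24 * C ^ 2 with hB
  set I1 := ∫ y : κ → ℝ, Real.exp (1 * ‖y‖) ∂μ with hI1
  set I2 := ∫ y : κ → ℝ, Real.exp ((2 * L) * ‖y‖) ∂μ with hI2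
  refine ⟨B / 2 * I1 + 6 * Real.exp (2 * L * m1) * I2, fun G hG s r hr0 hr1 => ?_⟩
  have hL := hG.L_nonneg
  obtain ⟨w, -, hw1, hw2⟩ := hG.grad
  set U : (κ → ℝ) → ℝ := fun y => G (s + r • y) - G s with hU
  have hGi := hG.integrable μ hexp s r
  have hUi : Integrable U μ := hGi.sub (integrable_const _)
  set m := ∫ y, U y ∂μ with hm
  have hmG : ∫ y, G (s + r • y) ∂μ = m + G s := by
    rw [hm, hU, integral_sub hGi (integrable_const _)]; simp
  have hUb : ∀ y, |U y| ≤ r * (L * ‖y‖) := by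
    intro y
    refine (hG.lip _ _).trans_eq ?_
    rw [add_sub_cancel_left, norm_smul, Real.norm_eq_abs, abs_of_nonneg hr0]; ring
  have hmb : |m| ≤ r * (L * m1) := by
    refine abs_integral_le_integral_abs.trans ?_
    refine (integral_mono hUi.abs ((hn.const_mul L).const_mul r) hUb).trans_eq ?_
    rw [integral_const_mul, integral_const_mul]
  set q : (κ → ℝ) → ℝ := fun y => L * ∑ k, |w s k| * (y k) ^ 2 with hq
  have hqi : Integrable q μ := (integrable_finsetSum _ fun k _ => (hy2 k).const_mul _).const_mul _
  have hqint : ∫ y, q y ∂μ ≤ L ^ 2 * v := by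
    rw [hq, integral_const_mul, integral_finsetSum _ fun k _ => (hy2 k).const_mul _]
    simp only [integral_const_mul]
    calc L * ∑ k, |w s k| * ∫ y, (y k) ^ 2 ∂μ ≤ L * ∑ k, |w s k| * v := by
          gcongr with k _; exact hv k
      _ = L * ((∑ k, |w s k|) * v) := by rw [Finset.sum_mul]
      _ ≤ L * (L * v) := by gcongr; exact hw1 s
      _ = _ := by ring
  have hU2 : ∀ y, U y ^ 2 ≤ r ^ 2 * q y + r ^ 3 * B * Real.exp (1 * ‖y‖) := by
    intro y
    set a := ∑ k, w s k * y k with ha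
    have ha2 : a ^ 2 ≤ q y := by
      have h1 : a ^ 2 ≤ (∑ k, |w s k|) * ∑ k, |w s k| * (y k) ^ 2 := by
        refine Finset.sum_sq_le_sum_mul_sum_of_sq_le_mul _ (fun _ _ => abs_nonneg _)
          (fun _ _ => by positivity) fun k _ => ?_
        rw [mul_pow, ← sq_abs (w s k)]; exact le_of_eq (by ring)
      exact h1.trans (mul_le_mul_of_nonneg_right (hw1 s)
        (Finset.sum_nonneg fun k _ => by positivity))
    have hab : |a| ≤ L * ‖y‖ := by
      calc |a| ≤ ∑ k, |w s k * y k| := Finset.abs_sum_le_sum_abs _ _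
        _ ≤ ∑ k, |w s k| * ‖y‖ := by
          gcongr with k _
          rw [abs_mul]
          gcongr
          exact norm_le_pi_norm y k
        _ ≤ L * ‖y‖ := by rw [← Finset.sum_mul]; gcongr; exact hw1 s
    set b := U y - r * a with hb
    have hbb : |b| ≤ C * r ^ 2 * ‖y‖ ^ 2 := by
      have := hw2 s (r • y)
      rw [norm_smul, Real.norm_eq_abs, abs_of_nonneg hr0] at this
      refine le_trans (le_of_eq ?_) (this.trans_eq (by ring))
      rw [hb, ha, Finset.mul_sum, hU]
      congr 2
      refine Finset.sum_congr rfl fun k _ => ?_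
      simp only [Pi.smul_apply, smul_eq_mul]; ring
    have hny := norm_nonneg y
    have e : U y ^ 2 = r ^ 2 * a ^ 2 + 2 * r * (a * b) + b ^ 2 := by
      rw [hb]; ring
    have t1 : a * b ≤ (L * ‖y‖) * (C * r ^ 2 * ‖y‖ ^ 2) := by
      refine (le_abs_self _).trans ?_
      rw [abs_mul]
      gcongr
    have t2 : b ^ 2 ≤ (C * r ^ 2 * ‖y‖ ^ 2) ^ 2 := by
      rw [← sq_abs]; gcongr
    have t3 := cube_le_exp hny
    have t4 := four_le_exp hny
    rw [e, one_mul]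
    calc r ^ 2 * a ^ 2 + 2 * r * (a * b) + b ^ 2
        ≤ r ^ 2 * q y + 2 * r * ((L * ‖y‖) * (C * r ^ 2 * ‖y‖ ^ 2)) + (C * r ^ 2 * ‖y‖ ^ 2) ^ 2 := by
          gcongr
      _ = r ^ 2 * q y + r ^ 3 * (2 * L * C * ‖y‖ ^ 3) + r ^ 3 * r * (C ^ 2 * ‖y‖ ^ 4) := by ring
      _ ≤ r ^ 2 * q y + r ^ 3 * (2 * L * C * (6 * Real.exp ‖y‖))
            + r ^ 3 * 1 * (C ^ 2 * (24 * Real.exp ‖y‖)) := by gcongr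
      _ = _ := by rw [hB]; ring
  have hpt : ∀ y, Real.exp (U y - m) ≤ (((1 - m) * U y + (1 - m + m ^ 2 / 2))
      + r ^ 2 / 2 * q y) + (r ^ 3 * B / 2 * Real.exp (1 * ‖y‖)
      + r ^ 3 * (6 * Real.exp (2 * L * m1)) * Real.exp ((2 * L) * ‖y‖)) := by
    intro y
    set W := U y - m with hW
    set Q := L * ‖y‖ + L * m1 with hQ
    have hQ0 : 0 ≤ Q := by positivity
    have hWQ : |W| ≤ r * Q := by
      have := abs_sub (U y) m
      have := hUb y
      rw [hQ]; linarith
    have hWQ' : |W| ≤ Q := hWQ.trans (mul_le_of_le_one_left hQ0 hr1)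
    have h1 := exp_le_cubic W
    have h2 : |W| ^ 3 * Real.exp |W| ≤
        r ^ 3 * (6 * Real.exp (2 * L * m1)) * Real.exp ((2 * L) * ‖y‖) := by
      calc |W| ^ 3 * Real.exp |W| ≤ (r * Q) ^ 3 * Real.exp Q := by gcongr
        _ = r ^ 3 * Q ^ 3 * Real.exp Q := by ring
        _ ≤ r ^ 3 * (6 * Real.exp Q) * Real.exp Q := by gcongr; exact cube_le_exp hQ0
        _ = r ^ 3 * 6 * (Real.exp Q * Real.exp Q) := by ring
        _ = r ^ 3 * 6 * (Real.exp (2 * L * m1) * Real.exp ((2 * L) * ‖y‖)) := by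
          rw [← Real.exp_add, ← Real.exp_add]; congr 2; rw [hQ]; ring
        _ = _ := by ring
    have h3 := hU2 y
    have h4 : W ^ 2 = U y ^ 2 - 2 * m * U y + m ^ 2 := by rw [hW]; ring
    rw [h4] at h1
    have h5 : W = U y - m := hW
    linarith
  have j1 : Integrable (fun y => (1 - m) * U y + (1 - m + m ^ 2 / 2)) μ :=
    (hUi.const_mul _).add (integrable_const _)
  have j2 : Integrable (fun y => r ^ 2 / 2 * q y) μ := hqi.const_mul _
  have j12 : Integrable (fun y => ((1 - m) * U y + (1 - m + m ^ 2 / 2)) + r ^ 2 / 2 * q y) μ :=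
    j1.add j2
  have j3 : Integrable (fun y : κ → ℝ => r ^ 3 * B / 2 * Real.exp (1 * ‖y‖)) μ :=
    (hexp _).const_mul _
  have j4 : Integrable (fun y : κ → ℝ => r ^ 3 * (6 * Real.exp (2 * L * m1)) *
    Real.exp ((2 * L) * ‖y‖)) μ := (hexp _).const_mul _
  have j34 : Integrable (fun y : κ → ℝ => r ^ 3 * B / 2 * Real.exp (1 * ‖y‖) +
    r ^ 3 * (6 * Real.exp (2 * L * m1)) * Real.exp ((2 * L) * ‖y‖)) μ := j3.add j4
  have hExp : ∀ y, Real.exp (G (s + r • y)) = Real.exp (m + G s) * Real.exp (U y - m) := by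
    intro y; rw [← Real.exp_add]; congr 1; rw [hU]; ring
  have hWi : Integrable (fun y => Real.exp (U y - m)) μ := by
    have := (hG.integrable_exp μ hexp s r).const_mul (Real.exp (m + G s))⁻¹
    refine this.congr (.of_forall fun y => ?_)
    simp only [hExp]
    rw [inv_mul_cancel_left₀ (Real.exp_pos _).ne']
  have hfin : ∫ y, Real.exp (U y - m) ∂μ ≤ Real.exp (r ^ 2 * (L ^ 2 * v / 2) +
      (B / 2 * I1 + 6 * Real.exp (2 * L * m1) * I2) * r ^ 3) := by
    refine (integral_mono hWi (j12.add j34) hpt).trans ?_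
    simp only [Pi.add_apply]
    rw [integral_add j12 j34, integral_add j1 j2, integral_add j3 j4,
      integral_add (hUi.const_mul _) (integrable_const _)]
    simp only [integral_const_mul, integral_const, probReal_univ, one_smul]
    rw [← hm, ← hI1, ← hI2]
    have h6 : r ^ 2 / 2 * ∫ y, q y ∂μ ≤ r ^ 2 / 2 * (L ^ 2 * v) := by gcongr
    have h7 := Real.add_one_le_exp (r ^ 2 * (L ^ 2 * v / 2) +
      (B / 2 * I1 + 6 * Real.exp (2 * L * m1) * I2) * r ^ 3)
    nlinarith [sq_nonneg m]
  simp only [hExp]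
  rw [integral_const_mul, hmG, add_assoc (m + G s), Real.exp_add (m + G s)]
  gcongr


lemma gauss_exp_integrable [IsGaussian μ] (a : ℝ) :
    Integrable (fun y => Real.exp (a * ‖y‖)) μ := by
  obtain ⟨c, hc, hintg⟩ := IsGaussian.exists_integrable_exp_sq μ
  refine (hintg.const_mul (Real.exp (a ^ 2 / (4 * c)))).mono' (by fun_prop)
    (.of_forall fun y => ?_)
  rw [Real.norm_eq_abs, Real.abs_exp, ← Real.exp_add, Real.exp_le_exp]
  have : a ^ 2 / (4 * c) + c * ‖y‖ ^ 2 - a * ‖y‖ = c * (‖y‖ - a / (2 * c)) ^ 2 := by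
    field_simp; ring
  have : 0 ≤ c * (‖y‖ - a / (2 * c)) ^ 2 := by positivity
  linarith

lemma gauss_conv [IsGaussian μ] (h0 : ∀ l : StrongDual ℝ (κ → ℝ), μ[l] = 0)
    {a b c : ℝ} (habc : a ^ 2 + b ^ 2 = c ^ 2) :
    (μ.prod μ).map (fun p => a • p.1 + b • p.2) = μ.map (fun y => c • y) := by
  have e1 : (fun p : (κ → ℝ) × (κ → ℝ) => a • p.1 + b • p.2) =
    ⇑(a • ContinuousLinearMap.fst ℝ (κ → ℝ) (κ → ℝ) +
      b • ContinuousLinearMap.snd ℝ (κ → ℝ) (κ → ℝ)) := by ext; simp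
  have e2 : (fun y : κ → ℝ => c • y) = ⇑(c • ContinuousLinearMap.id ℝ (κ → ℝ)) := by ext; simp
  have hv : ∀ (t : ℝ) (l : StrongDual ℝ (κ → ℝ)), Var[⇑(t • l); μ] = t ^ 2 * Var[⇑l; μ] := by
    intro t l
    exact variance_const_mul t l μ
  rw [e1, e2]
  refine Measure.ext_of_charFunDual ?_
  ext l
  have e3 : (l.comp (a • ContinuousLinearMap.fst ℝ (κ → ℝ) (κ → ℝ) +
      b • ContinuousLinearMap.snd ℝ (κ → ℝ) (κ → ℝ))).comp (.inl ℝ _ _) = a • l := by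
    ext; simp
  have e4 : (l.comp (a • ContinuousLinearMap.fst ℝ (κ → ℝ) (κ → ℝ) +
      b • ContinuousLinearMap.snd ℝ (κ → ℝ) (κ → ℝ))).comp (.inr ℝ _ _) = b • l := by
    ext; simp
  have e5 : l.comp (c • ContinuousLinearMap.id ℝ (κ → ℝ)) = c • l := by
    ext; simp
  rw [charFunDual_map, charFunDual_map, charFunDual_prod, e3, e4, e5,
    IsGaussian.charFunDual_eq_of_forall_strongDual_eq_zero h0,
    IsGaussian.charFunDual_eq_of_forall_strongDual_eq_zero h0,
    IsGaussian.charFunDual_eq_of_forall_strongDual_eq_zero h0, ← Complex.exp_add, hv, hv, hv, ← habc]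
  congr 1
  push_cast
  ring

lemma gauss_conv_integral [IsGaussian μ] (h0 : ∀ l : StrongDual ℝ (κ → ℝ), μ[l] = 0)
    {a b c : ℝ} (habc : a ^ 2 + b ^ 2 = c ^ 2) {H : (κ → ℝ) → ℝ} (hH : Measurable H)
    (hi : Integrable (fun y => H (c • y)) μ) :
    Integrable (fun y => ∫ z, H (a • y + b • z) ∂μ) μ ∧
    ∫ y, H (c • y) ∂μ = ∫ y, ∫ z, H (a • y + b • z) ∂μ ∂μ := by
  have hm := gauss_conv μ h0 habc
  have hmeas1 : Measurable (fun y : κ → ℝ => c • y) := by fun_prop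
  have hmeas2 : Measurable (fun p : (κ → ℝ) × (κ → ℝ) => a • p.1 + b • p.2) := by fun_prop
  have i1 : Integrable H (μ.map (fun y => c • y)) :=
    (integrable_map_measure hH.aestronglyMeasurable hmeas1.aemeasurable).2 hi
  have e1 : ∫ y, H y ∂(μ.map (fun y => c • y)) = ∫ y, H (c • y) ∂μ :=
    integral_map hmeas1.aemeasurable hH.aestronglyMeasurable
  rw [← hm] at i1 e1
  have i2 := (integrable_map_measure hH.aestronglyMeasurable hmeas2.aemeasurable).1 i1
  rw [integral_map hmeas2.aemeasurable hH.aestronglyMeasurable] at e1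
  refine ⟨i2.integral_prod_left, ?_⟩
  rw [← e1]
  exact integral_prod _ i2

lemma iter [IsGaussian μ] (h0 : ∀ l : StrongDual ℝ (κ → ℝ), μ[l] = 0) (r ε : ℝ)
    (hstep : ∀ G : (κ → ℝ) → ℝ, Good L C G → ∀ s,
      ∫ y, Real.exp (G (s + r • y)) ∂μ ≤ Real.exp (∫ y, G (s + r • y) ∂μ + ε)) (k : ℕ) :
    ∀ G : (κ → ℝ) → ℝ, Good L C G → ∀ s,
      ∫ y, Real.exp (G (s + (√k * r) • y)) ∂μ ≤
        Real.exp (∫ y, G (s + (√k * r) • y) ∂μ + k * ε) := by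
  have hexp := gauss_exp_integrable μ
  induction k with
  | zero => intro G hG s; simp
  | succ k ih =>
    intro G hG s
    have habc : (√k * r) ^ 2 + r ^ 2 = (√(k + 1 : ℕ) * r) ^ 2 := by
      rw [mul_pow, mul_pow, Real.sq_sqrt (by positivity), Real.sq_sqrt (by positivity)]
      push_cast; ring
    have hGm := hG.measurable
    obtain ⟨a1, a2⟩ := gauss_conv_integral μ h0 habc (H := fun z => G (s + z)) (by fun_prop)
      (hG.integrable μ hexp s _)
    obtain ⟨b1, b2⟩ := gauss_conv_integral μ h0 habc (H := fun z => Real.exp (G (s + z)))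
      (by fun_prop) (hG.integrable_exp μ hexp s _)
    have hA := hG.avg μ hexp r
    have hih := ih _ hA s
    simp only [← add_assoc] at a2 b1 b2
    rw [a2, b2]
    calc ∫ y, ∫ z, Real.exp (G (s + (√k * r) • y + r • z)) ∂μ ∂μ
        ≤ ∫ y, Real.exp (∫ z, G (s + (√k * r) • y + r • z) ∂μ) * Real.exp ε ∂μ := by
          refine integral_mono b1 ((hA.integrable_exp μ hexp s _).mul_const _) fun y => ?_
          rw [← Real.exp_add]
          exact hstep G hG _
      _ = (∫ y, Real.exp (∫ z, G (s + (√k * r) • y + r • z) ∂μ) ∂μ) * Real.exp ε :=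
          integral_mul_const _ _
      _ ≤ Real.exp (∫ y, ∫ z, G (s + (√k * r) • y + r • z) ∂μ ∂μ + k * ε) * Real.exp ε := by
          gcongr
      _ = _ := by rw [← Real.exp_add]; congr 1; push_cast; ring

lemma gauss_good [IsGaussian μ] (h0 : ∀ l : StrongDual ℝ (κ → ℝ), μ[l] = 0)
    (v : ℝ) (hv : ∀ k, ∫ y, (y k) ^ 2 ∂μ ≤ v) (hv0 : 0 ≤ v) (hC : 0 ≤ C) (hG : Good L C G) :
    ∫ y, Real.exp (G y) ∂μ ≤ Real.exp (∫ y, G y ∂μ + L ^ 2 * v / 2) := by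
  obtain ⟨K, hK⟩ := one_step (L := L) μ (gauss_exp_integrable μ) v hv hv0 hC
  have key : ∀ n : ℕ, ∫ y, Real.exp (G y) ∂μ ≤
      Real.exp (∫ y, G y ∂μ + L ^ 2 * v / 2 + K * (√(n + 1 : ℕ))⁻¹) := by
    intro n
    set N := n + 1 with hN
    have hpos : 0 < √(N : ℝ) := by rw [Real.sqrt_pos, hN]; positivity
    have h1N : 1 ≤ √(N : ℝ) := by
      rw [Real.one_le_sqrt, hN]; push_cast; linarith [n.cast_nonneg (α := ℝ)]
    have hsq : √(N : ℝ) ^ 2 = N := Real.sq_sqrt (by positivity)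
    have := iter μ h0 (√(N : ℝ))⁻¹ _ (fun G hG s => by
      have := hK G hG s (√(N : ℝ))⁻¹ (by positivity) (inv_le_one_of_one_le₀ h1N)
      rw [add_assoc] at this
      exact this) N G hG 0
    simp only [mul_inv_cancel₀ hpos.ne', one_smul, zero_add] at this
    refine this.trans_eq ?_
    generalize √(N : ℝ) = x at hpos hsq
    congr 1
    rw [← hsq]
    field_simp
    ring
  have hlim : Filter.Tendsto (fun n : ℕ => Real.exp (∫ y, G y ∂μ + L ^ 2 * v / 2
      + K * (√(n + 1 : ℕ))⁻¹)) Filter.atTop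
      (nhds (Real.exp (∫ y, G y ∂μ + L ^ 2 * v / 2 + K * 0))) := by
    refine (Real.continuous_exp.tendsto _).comp (tendsto_const_nhds.add
      (tendsto_const_nhds.mul ?_))
    refine tendsto_inv_atTop_zero.comp (Real.tendsto_sqrt_atTop.comp ?_)
    exact tendsto_natCast_atTop_atTop.comp (Filter.tendsto_add_atTop_nat 1)
  have := ge_of_tendsto' hlim key
  simpa using this


lemma exp_le_add_exp_sq (x : ℝ) : Real.exp x ≤ x + Real.exp (x ^ 2) := by
  rcases le_or_gt |x| 1 with h | h
  · have h1 := (abs_le.1 (Real.abs_exp_sub_one_sub_id_le h)).2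
    have h2 := Real.add_one_le_exp (x ^ 2)
    linarith
  · rcases lt_abs.1 h with h | h
    · have : Real.exp x ≤ Real.exp (x ^ 2) := Real.exp_le_exp.2 (by nlinarith)
      linarith
    · have h1 : Real.exp x ≤ 1 := Real.exp_le_one_iff.2 (by linarith)
      have h2 := Real.add_one_le_exp (x ^ 2)
      nlinarith

/-- soft maximum -/
noncomputable def smax (β : ℝ) (c : κ → ℝ) (x : κ → ℝ) : ℝ :=
  β⁻¹ * Real.log (∑ k, Real.exp (β * (x k + c k)))

variable [Nonempty κ]

lemma S_pos (β : ℝ) (c x : κ → ℝ) : 0 < ∑ k, Real.exp (β * (x k + c k)) :=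
  Finset.sum_pos (fun _ _ => Real.exp_pos _) Finset.univ_nonempty

lemma smax_le {β : ℝ} (hβ : 0 < β) (c x y : κ → ℝ) : smax β c x ≤ smax β c y + ‖x - y‖ := by
  have h : Real.log (∑ k, Real.exp (β * (x k + c k))) ≤
      β * ‖x - y‖ + Real.log (∑ k, Real.exp (β * (y k + c k))) := by
    rw [Real.log_le_iff_le_exp (S_pos β c x), Real.exp_add, Real.exp_log (S_pos β c y),
      Finset.mul_sum]
    gcongr with k _
    rw [← Real.exp_add, Real.exp_le_exp]
    have : x k - y k ≤ ‖x - y‖ := (le_abs_self _).trans (norm_le_pi_norm (x - y) k)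
    nlinarith
  unfold smax
  calc _ ≤ β⁻¹ * (β * ‖x - y‖ + Real.log (∑ k, Real.exp (β * (y k + c k)))) := by gcongr
    _ = _ := by field_simp; ring

lemma smax_good {β : ℝ} (hβ : 0 < β) (c : κ → ℝ) : Good 1 (4 * β) (smax β c) := by
  have hS := S_pos β c
  refine ⟨fun x y => ?_, fun s k => Real.exp (β * (s k + c k)) / ∑ j, Real.exp (β * (s j + c j)),
    ?_, fun s => ?_, fun s h => ?_⟩
  · rw [abs_le]
    have h1 := smax_le hβ c x y
    have h2 := smax_le hβ c y x
    rw [norm_sub_rev] at h2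
    constructor <;> linarith
  · refine measurable_pi_lambda _ fun k => ?_
    fun_prop
  · simp only [abs_div, Real.abs_exp, abs_of_pos (hS s), ← Finset.sum_div]
    rw [div_self (hS s).ne']
  · set p : κ → ℝ := fun k => Real.exp (β * (s k + c k)) / ∑ j, Real.exp (β * (s j + c j)) with hp
    have hp0 : ∀ k, 0 ≤ p k := fun k => div_nonneg (Real.exp_pos _).le (hS s).le
    have hp1 : ∑ k, p k = 1 := by
      rw [hp, ← Finset.sum_div, div_self (hS s).ne']
    set a := ∑ k, p k * h k with ha
    have hab : |a| ≤ ‖h‖ := by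
      calc |a| ≤ ∑ k, |p k * h k| := Finset.abs_sum_le_sum_abs _ _
        _ ≤ ∑ k, p k * ‖h‖ := by
          gcongr with k _
          rw [abs_mul, abs_of_nonneg (hp0 k)]
          exact mul_le_mul_of_nonneg_left (norm_le_pi_norm h k) (hp0 k)
        _ = ‖h‖ := by rw [← Finset.sum_mul, hp1, one_mul]
    set b : κ → ℝ := fun k => β * (h k - a) with hb
    have hbsum : ∑ k, p k * b k = 0 := by
      have : ∑ k, p k * b k = β * (∑ k, p k * h k - (∑ k, p k) * a) := by
        rw [Finset.sum_mul, ← Finset.sum_sub_distrib, Finset.mul_sum]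
        exact Finset.sum_congr rfl fun k _ => by rw [hb]; ring
      rw [this, hp1, ← ha]; ring
    have hbb : ∀ k, b k ^ 2 ≤ 4 * β ^ 2 * ‖h‖ ^ 2 := by
      intro k
      have h1 : |h k - a| ≤ 2 * ‖h‖ := by
        have := abs_sub (h k) a
        have : |h k| ≤ ‖h‖ := norm_le_pi_norm h k
        linarith
      calc b k ^ 2 = β ^ 2 * |h k - a| ^ 2 := by rw [sq_abs, hb]; ring
        _ ≤ β ^ 2 * (2 * ‖h‖) ^ 2 := by gcongr
        _ = _ := by ring
    set X := ∑ k, p k * Real.exp (b k) with hX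
    have hX1 : 1 ≤ X := by
      calc (1 : ℝ) = ∑ k, p k * (b k + 1) := by
            simp only [mul_add, mul_one, Finset.sum_add_distrib, hbsum, hp1, zero_add]
        _ ≤ X := Finset.sum_le_sum fun k _ =>
            mul_le_mul_of_nonneg_left (Real.add_one_le_exp _) (hp0 k)
    have hX2 : X ≤ Real.exp (4 * β ^ 2 * ‖h‖ ^ 2) := by
      calc X ≤ ∑ k, p k * (b k + Real.exp (4 * β ^ 2 * ‖h‖ ^ 2)) := Finset.sum_le_sum fun k _ =>
            mul_le_mul_of_nonneg_left ((exp_le_add_exp_sq _).trans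
              (by gcongr; exact hbb k)) (hp0 k)
        _ = _ := by
            simp only [mul_add, Finset.sum_add_distrib, hbsum, ← Finset.sum_mul, hp1, zero_add,
              one_mul]
    have hSX : ∑ k, Real.exp (β * ((s + h) k + c k)) =
        (∑ k, Real.exp (β * (s k + c k))) * (Real.exp (β * a) * X) := by
      rw [hX, Finset.mul_sum, Finset.mul_sum]
      refine Finset.sum_congr rfl fun k _ => ?_
      have : Real.exp (β * ((s + h) k + c k)) =
          Real.exp (β * (s k + c k)) * (Real.exp (β * a) * Real.exp (b k)) := by
        rw [← Real.exp_add, ← Real.exp_add]; congr 1; rw [hb, Pi.add_apply]; ring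
      rw [this, hp]
      have := (hS s).ne'
      field_simp
    have hX0 : 0 < X := by linarith
    have hdiff : smax β c (s + h) - smax β c s - a = β⁻¹ * Real.log X := by
      unfold smax
      rw [hSX, Real.log_mul (hS s).ne' (by positivity), Real.log_mul (by positivity) hX0.ne',
        Real.log_exp]
      field_simp
      ring
    rw [hdiff, abs_of_nonneg (mul_nonneg (by positivity) (Real.log_nonneg hX1))]
    have : Real.log X ≤ 4 * β ^ 2 * ‖h‖ ^ 2 := (Real.log_le_iff_le_exp hX0).2 hX2
    calc β⁻¹ * Real.log X ≤ β⁻¹ * (4 * β ^ 2 * ‖h‖ ^ 2) := by gcongr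
      _ = _ := by field_simp

/-- hard maximum -/
noncomputable def hmax (c : κ → ℝ) (x : κ → ℝ) : ℝ :=
  Finset.univ.sup' Finset.univ_nonempty fun k => x k + c k

lemma hmax_le_smax {β : ℝ} (hβ : 0 < β) (c x : κ → ℝ) : hmax c x ≤ smax β c x := by
  refine Finset.sup'_le _ _ fun k _ => ?_
  unfold smax
  rw [le_inv_mul_iff₀ hβ, Real.le_log_iff_exp_le (S_pos β c x)]
  exact Finset.single_le_sum (f := fun k => Real.exp (β * (x k + c k)))
    (fun _ _ => (Real.exp_pos _).le) (Finset.mem_univ k)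

lemma smax_le_hmax {β : ℝ} (hβ : 0 < β) (c x : κ → ℝ) :
    smax β c x ≤ hmax c x + β⁻¹ * Real.log (Fintype.card κ) := by
  have hc : (0 : ℝ) < Fintype.card κ := by exact_mod_cast Fintype.card_pos
  have : Real.log (∑ k, Real.exp (β * (x k + c k))) ≤
      β * hmax c x + Real.log (Fintype.card κ) := by
    rw [Real.log_le_iff_le_exp (S_pos β c x), Real.exp_add, Real.exp_log hc]
    calc ∑ k, Real.exp (β * (x k + c k)) ≤ ∑ k : κ, Real.exp (β * hmax c x) := by
          gcongr with k _
          exact Finset.le_sup' (fun k => x k + c k) (Finset.mem_univ k)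
      _ = _ := by simp [mul_comm]
  unfold smax
  calc _ ≤ β⁻¹ * (β * hmax c x + Real.log (Fintype.card κ)) := by gcongr
    _ = _ := by field_simp

lemma hmax_measurable (c : κ → ℝ) : Measurable (hmax c) := by
  unfold hmax
  have : Measurable (Finset.univ.sup' Finset.univ_nonempty fun (k : κ) (x : κ → ℝ) => x k + c k) :=
    Finset.measurable_sup' _ fun k _ => by fun_prop
  convert this using 1
  ext x
  rw [Finset.sup'_apply]

lemma gauss_hmax [IsGaussian μ] (h0 : ∀ l : StrongDual ℝ (κ → ℝ), μ[l] = 0)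
    (v : ℝ) (hv : ∀ k, ∫ y, (y k) ^ 2 ∂μ ≤ v) (hv0 : 0 ≤ v) (c : κ → ℝ) :
    ∀ t : ℝ, Integrable (fun y => Real.exp (t * hmax c y)) μ ∧
      ∫ y, Real.exp (t * hmax c y) ∂μ ≤ Real.exp (t * ∫ y, hmax c y ∂μ + v * t ^ 2 / 2) := by
  intro t
  have hexp := gauss_exp_integrable μ
  have hM := hmax_measurable c
  have hcard : 0 ≤ Real.log (Fintype.card κ) :=
    Real.log_nonneg (by exact_mod_cast Fintype.card_pos)
  set D := |t| * Real.log (Fintype.card κ) with hD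
  have hdist : ∀ β : ℝ, 0 < β → ∀ x, |t * hmax c x - t * smax β c x| ≤ β⁻¹ * D := by
    intro β hβ x
    rw [← mul_sub, abs_mul, abs_sub_comm, abs_of_nonneg (sub_nonneg.2 (hmax_le_smax hβ c x)), hD,
      mul_left_comm]
    gcongr
    linarith [smax_le_hmax hβ c x]
  have hg : ∀ β : ℝ, 0 < β → Good |t| (|t| * (4 * β)) (fun x => t * smax β c x) := by
    intro β hβ
    simpa using (smax_good hβ c).smul t
  have hiF : ∀ β : ℝ, 0 < β → Integrable (fun x => t * smax β c x) μ := fun β hβ => by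
    simpa using (hg β hβ).integrable μ hexp 0 1
  have hieF : ∀ β : ℝ, 0 < β → Integrable (fun x => Real.exp (t * smax β c x)) μ := fun β hβ => by
    simpa using (hg β hβ).integrable_exp μ hexp 0 1
  have hiM : Integrable (fun x => t * hmax c x) μ := by
    have : Integrable (fun x => t * hmax c x - t * smax 1 c x) μ :=
      (integrable_const ((1 : ℝ)⁻¹ * D)).mono'
        ((hM.const_mul t).sub (hg 1 one_pos).measurable).aestronglyMeasurable
        (.of_forall fun x => hdist 1 one_pos x)
    exact (this.add (hiF 1 one_pos)).congr (.of_forall fun x => by simp)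
  have hle : ∀ β : ℝ, 0 < β → ∀ x,
      Real.exp (t * hmax c x) ≤ Real.exp (β⁻¹ * D) * Real.exp (t * smax β c x) := by
    intro β hβ x
    rw [← Real.exp_add, Real.exp_le_exp]
    linarith [(abs_le.1 (hdist β hβ x)).2]
  have hieM : Integrable (fun x => Real.exp (t * hmax c x)) μ :=
    ((hieF 1 one_pos).const_mul (Real.exp ((1 : ℝ)⁻¹ * D))).mono'
      (hM.const_mul t).exp.aestronglyMeasurable
      (.of_forall fun x => by rw [Real.norm_eq_abs, Real.abs_exp]; exact hle 1 one_pos x)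
  refine ⟨hieM, ?_⟩
  have key : ∀ β : ℝ, 0 < β → ∫ y, Real.exp (t * hmax c y) ∂μ ≤
      Real.exp (t * ∫ y, hmax c y ∂μ + v * t ^ 2 / 2 + β⁻¹ * (2 * D)) := by
    intro β hβ
    have h1 := gauss_good μ h0 v hv hv0 (by positivity) (hg β hβ)
    have h2 : ∫ y, t * smax β c y ∂μ ≤ t * ∫ y, hmax c y ∂μ + β⁻¹ * D := by
      have : ∫ y, t * smax β c y ∂μ ≤ ∫ y, (t * hmax c y + β⁻¹ * D) ∂μ :=
        integral_mono (hiF β hβ) (hiM.add (integrable_const _)) fun x => by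
          linarith [(abs_le.1 (hdist β hβ x)).1]
      refine this.trans_eq ?_
      rw [integral_add hiM (integrable_const _), integral_const_mul]; simp
    calc ∫ y, Real.exp (t * hmax c y) ∂μ
        ≤ ∫ y, Real.exp (β⁻¹ * D) * Real.exp (t * smax β c y) ∂μ :=
          integral_mono hieM ((hieF β hβ).const_mul _) (hle β hβ)
      _ = Real.exp (β⁻¹ * D) * ∫ y, Real.exp (t * smax β c y) ∂μ := integral_const_mul _ _
      _ ≤ Real.exp (β⁻¹ * D) * Real.exp (∫ y, t * smax β c y ∂μ + |t| ^ 2 * v / 2) := by gcongr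
      _ ≤ Real.exp (β⁻¹ * D) *
          Real.exp (t * ∫ y, hmax c y ∂μ + β⁻¹ * D + |t| ^ 2 * v / 2) := by gcongr
      _ = _ := by rw [← Real.exp_add, sq_abs]; congr 1; ring
  have hlim : Filter.Tendsto (fun β : ℝ => Real.exp (t * ∫ y, hmax c y ∂μ + v * t ^ 2 / 2
      + β⁻¹ * (2 * D))) Filter.atTop
      (nhds (Real.exp (t * ∫ y, hmax c y ∂μ + v * t ^ 2 / 2 + 0 * (2 * D)))) :=
    (Real.continuous_exp.tendsto _).comp (tendsto_const_nhds.add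
      (tendsto_inv_atTop_zero.mul tendsto_const_nhds))
  have := ge_of_tendsto hlim ((Filter.eventually_gt_atTop 0).mono key)
  simpa using this

end

/-- sign attached to a boolean -/
def sg (b : Bool) : ℝ := if b then 1 else -1

lemma finite_level {Ω : Type*} [MeasurableSpace Ω] (P : Measure Ω) [IsProbabilityMeasure P]
    (n : ℕ) (F : Fin n → Ω → ℝ) (hn : 0 < n) (hF : ∀ i, Measurable (F i))
    (hgauss : ∀ u : Fin n → ℝ, ∃ v : NNReal,
        P.map (fun ω => ∑ i, u i * F i ω) = gaussianReal 0 v)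
    (v : ℝ) (hv0 : 0 ≤ v) (hv : ∀ i, ∫ ω, (F i ω) ^ 2 ∂P ≤ v) (c : Fin n → ℝ) (t : ℝ)
    (Zn : Ω → ℝ) (hZn : ∀ ω, IsGreatest (Set.range fun i => |F i ω + c i|) (Zn ω)) :
    Measurable Zn ∧ Integrable (fun ω => Real.exp (t * Zn ω)) P ∧
      ∫ ω, Real.exp (t * Zn ω) ∂P ≤ Real.exp (t * ∫ ω, Zn ω ∂P + v * t ^ 2 / 2) := by
  have : Nonempty (Fin n) := ⟨⟨0, hn⟩⟩
  set Y : Ω → (Fin n × Bool → ℝ) := fun ω k => sg k.2 * F k.1 ω with hY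
  have hYm : Measurable Y := measurable_pi_lambda _ fun k => (hF k.1).const_mul _
  set c' : Fin n × Bool → ℝ := fun k => sg k.2 * c k.1 with hc'
  set μ := P.map Y with hμ
  have hmap : ∀ l : StrongDual ℝ (Fin n × Bool → ℝ), ∃ w : NNReal,
      μ.map l = gaussianReal 0 w := by
    intro l
    obtain ⟨w, hw⟩ := hgauss fun i => ∑ b, l (Pi.single (i, b) 1) * sg b
    refine ⟨w, ?_⟩
    rw [← hw, hμ, Measure.map_map (by fun_prop) hYm]
    congr 1
    ext ω
    have h1 := LinearMap.pi_apply_eq_sum_univ (l : (Fin n × Bool → ℝ) →ₗ[ℝ] ℝ) (Y ω)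
    simp only [ContinuousLinearMap.coe_coe] at h1
    rw [Function.comp_apply, h1, Fintype.sum_prod_type]
    refine Finset.sum_congr rfl fun i _ => ?_
    rw [Finset.sum_mul]
    refine Finset.sum_congr rfl fun b _ => ?_
    have : (fun j => if (i, b) = j then (1 : ℝ) else 0) = Pi.single (i, b) 1 := by
      ext j; simp [Pi.single_apply, eq_comm]
    rw [this, hY, smul_eq_mul]
    ring
  have hG : IsGaussian μ := isGaussian_of_map_eq_gaussianReal fun l => ⟨0, hmap l⟩
  have h0 : ∀ l : StrongDual ℝ (Fin n × Bool → ℝ), μ[l] = 0 := by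
    intro l
    obtain ⟨w, hw⟩ := hmap l
    have : ∫ x, x ∂(μ.map l) = ∫ y, l y ∂μ :=
      integral_map (by fun_prop) (by fun_prop)
    rw [← this, hw, integral_id_gaussianReal]
  have hvar : ∀ k, ∫ y, (y k) ^ 2 ∂μ ≤ v := by
    intro k
    rw [hμ, integral_map hYm.aemeasurable
      ((measurable_pi_apply k).pow_const 2).aestronglyMeasurable]
    refine le_trans (le_of_eq ?_) (hv k.1)
    congr 1
    ext ω
    rw [hY]
    simp only [mul_pow, sg]
    split_ifs <;> norm_num
  have hZY : ∀ ω, Zn ω = hmax c' (Y ω) := by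
    intro ω
    obtain ⟨⟨i, hi⟩, h2⟩ := hZn ω
    have hterm : ∀ k : Fin n × Bool, Y ω k + c' k = sg k.2 * (F k.1 ω + c k.1) := by
      intro k; rw [hY, hc']; ring
    apply le_antisymm
    · rw [← hi]
      unfold hmax
      rcases abs_choice (F i ω + c i) with h | h
      · have := Finset.le_sup' (fun k => Y ω k + c' k) (Finset.mem_univ (i, true))
        rw [hterm] at this
        simp only [sg, if_true, one_mul] at this
        simp only [h]
        exact this
      · have := Finset.le_sup' (fun k => Y ω k + c' k) (Finset.mem_univ (i, false))
        rw [hterm] at this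
        have e : sg (i, false).2 = -1 := by simp [sg]
        rw [e, neg_one_mul] at this
        simp only [h]
        exact this
    · refine Finset.sup'_le _ _ fun k _ => ?_
      rw [hterm]
      refine le_trans ?_ (h2 ⟨k.1, rfl⟩)
      simp only [sg]
      split_ifs
      · rw [one_mul]; exact le_abs_self _
      · rw [neg_one_mul]; exact neg_le_abs _
  have hZY' : Zn = fun ω => hmax c' (Y ω) := funext hZY
  obtain ⟨a1, a2⟩ := gauss_hmax μ h0 v hvar hv0 c' t
  have hM := hmax_measurable c'
  rw [hμ, integral_map hYm.aemeasurable (hM.const_mul t).exp.aestronglyMeasurable,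
    integral_map hYm.aemeasurable hM.aestronglyMeasurable] at a2
  rw [hμ, integrable_map_measure (hM.const_mul t).exp.aestronglyMeasurable hYm.aemeasurable] at a1
  rw [hZY']
  exact ⟨hM.comp hYm, a1, a2⟩

lemma limit_level {Ω : Type*} [MeasurableSpace Ω] (P : Measure Ω) [IsProbabilityMeasure P]
    (Zn : ℕ → Ω → ℝ) (Z : Ω → ℝ) (hZ : Integrable Z P) (v : ℝ) (t : ℝ)
    (hZn : ∀ n, Measurable (Zn n))
    (hintg : ∀ n, Integrable (fun ω => Real.exp (t * Zn n ω)) P)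
    (hle : ∀ n, ∫ ω, Real.exp (t * Zn n ω) ∂P ≤ Real.exp (t * ∫ ω, Zn n ω ∂P + v * t ^ 2 / 2))
    (hbd : ∀ n, ∀ᵐ ω ∂P, |Zn n ω| ≤ Z ω)
    (hlim : ∀ᵐ ω ∂P, Filter.Tendsto (fun n => Zn n ω) Filter.atTop (nhds (Z ω))) :
    Integrable (fun ω => Real.exp (t * Z ω)) P ∧
      ∫ ω, Real.exp (t * Z ω) ∂P ≤ Real.exp (t * ∫ ω, Z ω ∂P + v * t ^ 2 / 2) := by
  have hE : Filter.Tendsto (fun n => ∫ ω, Zn n ω ∂P) Filter.atTop (nhds (∫ ω, Z ω ∂P)) :=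
    tendsto_integral_of_dominated_convergence Z (fun n => (hZn n).aestronglyMeasurable) hZ
      hbd hlim
  set A := Real.exp (t * ∫ ω, Z ω ∂P + v * t ^ 2 / 2) with hA
  have hAlim : Filter.Tendsto (fun n => ENNReal.ofReal
      (Real.exp (t * ∫ ω, Zn n ω ∂P + v * t ^ 2 / 2))) Filter.atTop (nhds (ENNReal.ofReal A)) :=
    (ENNReal.continuous_ofReal.tendsto _).comp ((Real.continuous_exp.tendsto _).comp
      ((tendsto_const_nhds.mul hE).add tendsto_const_nhds))
  have hfat : ∫⁻ ω, ENNReal.ofReal (Real.exp (t * Z ω)) ∂P ≤ ENNReal.ofReal A := by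
    calc ∫⁻ ω, ENNReal.ofReal (Real.exp (t * Z ω)) ∂P
        = ∫⁻ ω, Filter.liminf (fun n => ENNReal.ofReal (Real.exp (t * Zn n ω))) Filter.atTop ∂P := by
          refine lintegral_congr_ae ?_
          filter_upwards [hlim] with ω hω
          refine (Filter.Tendsto.liminf_eq ?_).symm
          exact (ENNReal.continuous_ofReal.tendsto _).comp ((Real.continuous_exp.tendsto _).comp
            (tendsto_const_nhds.mul hω))
      _ ≤ Filter.liminf (fun n => ∫⁻ ω, ENNReal.ofReal (Real.exp (t * Zn n ω)) ∂P) Filter.atTop :=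
          lintegral_liminf_le fun n => by have := hZn n; fun_prop
      _ ≤ Filter.liminf (fun n => ENNReal.ofReal
            (Real.exp (t * ∫ ω, Zn n ω ∂P + v * t ^ 2 / 2))) Filter.atTop := by
          refine Filter.liminf_le_liminf (.of_forall fun n => ?_)
          rw [← ofReal_integral_eq_lintegral_ofReal (hintg n) (.of_forall fun ω => (Real.exp_pos _).le)]
          exact ENNReal.ofReal_le_ofReal (hle n)
      _ = ENNReal.ofReal A := hAlim.liminf_eq
  have hms : AEStronglyMeasurable (fun ω => Real.exp (t * Z ω)) P :=
    Real.continuous_exp.comp_aestronglyMeasurable (hZ.aestronglyMeasurable.const_mul t)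
  have hI : Integrable (fun ω => Real.exp (t * Z ω)) P := by
    refine ⟨hms, ?_⟩
    rw [hasFiniteIntegral_iff_ofReal (.of_forall fun ω => (Real.exp_pos _).le)]
    exact hfat.trans_lt ENNReal.ofReal_lt_top
  refine ⟨hI, ?_⟩
  rw [← ofReal_integral_eq_lintegral_ofReal hI (.of_forall fun ω => (Real.exp_pos _).le)] at hfat
  exact (ENNReal.ofReal_le_ofReal_iff (Real.exp_pos _).le).1 hfat

end GaussConc


/-- **Lemma 3.1 of the paper.** Let `(f_r)_{r ∈ [0,T]}` be a centered Gaussian process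
with a.s. continuous sample paths (all finite-dimensional marginals are centered
Gaussian vectors, i.e. every linear combination of marginals is a centered, possibly
degenerate, Gaussian real random variable), let `g : [0,T] → ℝ` be continuous and
deterministic, let `σ = sup_{r ∈ [0,T]} (E[f_r²])^{1/2}` with `0 < σ < ∞`, and let
`Z = sup_{r ∈ [0,T]} |f_r + g(r)|` be integrable. Then for every `t ≥ 0`,
`P(|Z − E[Z]| > t) ≤ 2 exp(−t²/(2σ²))`. -/
theorem stmt1 {Ω : Type*} [MeasurableSpace Ω] (P : Measure Ω) [IsProbabilityMeasure P]
    (T : ℝ) (hT : 0 < T) (f : ℝ → Ω → ℝ) (g : ℝ → ℝ)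
    (hfmeas : ∀ r, Measurable (f r))
    (hconts : ∀ᵐ ω ∂P, ContinuousOn (fun r => f r ω) (Set.Icc 0 T))
    (hg : ContinuousOn g (Set.Icc 0 T))
    (hgauss : ∀ (n : ℕ) (r : Fin n → ℝ), (∀ i, r i ∈ Set.Icc 0 T) →
      ∀ u : Fin n → ℝ, ∃ v : NNReal,
        P.map (fun ω => ∑ i, u i * f (r i) ω) = gaussianReal 0 v)
    (hbdd : BddAbove (Set.range fun r : Set.Icc (0:ℝ) T =>
      Real.sqrt (∫ ω, (f r.1 ω) ^ 2 ∂P)))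
    (σ : ℝ) (hσ : σ = ⨆ r : Set.Icc (0:ℝ) T, Real.sqrt (∫ ω, (f r.1 ω) ^ 2 ∂P))
    (hσpos : 0 < σ)
    (Z : Ω → ℝ) (hZ : ∀ ω, Z ω = ⨆ r : Set.Icc (0:ℝ) T, |f r.1 ω + g r.1|)
    (hZint : Integrable Z P)
    (t : ℝ) (ht : 0 ≤ t) :
    (P {ω | t < |Z ω - ∫ ω', Z ω' ∂P|}).toReal ≤ 2 * Real.exp (-t ^ 2 / (2 * σ ^ 2)) := by
  have hσ2 : ∀ r ∈ Set.Icc (0:ℝ) T, ∫ ω, (f r ω) ^ 2 ∂P ≤ σ ^ 2 := by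
    intro r hr
    have h1 := le_ciSup hbdd ⟨r, hr⟩
    rw [← hσ] at h1
    exact (Real.sqrt_le_left hσpos.le).1 h1
  have hne : Nonempty (Set.Icc (0:ℝ) T) := ⟨⟨0, by simp [hT.le]⟩⟩
  set q : ℕ → Set.Icc (0:ℝ) T := TopologicalSpace.denseSeq _ with hq
  have hqd : DenseRange q := TopologicalSpace.denseRange_denseSeq _
  set Zn : ℕ → Ω → ℝ := fun n ω => Finset.univ.sup' (Finset.univ_nonempty (α := Fin (n + 1)))
    fun i => |f (q i) ω + g (q i)| with hZn
  have hgr : ∀ n ω, IsGreatest (Set.range fun i : Fin (n + 1) => |f (q i) ω + g (q i)|)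
      (Zn n ω) := by
    intro n ω
    refine ⟨?_, ?_⟩
    · obtain ⟨i, -, hi⟩ := Finset.exists_mem_eq_sup' (Finset.univ_nonempty (α := Fin (n + 1)))
        fun i => |f (q i) ω + g (q i)|
      exact ⟨i, hi.symm⟩
    · rintro _ ⟨i, rfl⟩
      exact Finset.le_sup' (fun i : Fin (n + 1) => |f (q i) ω + g (q i)|) (Finset.mem_univ i)
  have hfin : ∀ n (s : ℝ), _ := fun n s => GaussConc.finite_level P (n + 1)
    (fun i => f (q i)) n.succ_pos (fun i => hfmeas _)
    (hgauss (n + 1) (fun i => q i) fun i => (q i).2) (σ ^ 2) (sq_nonneg σ)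
    (fun i => hσ2 _ (q i).2) (fun i => g (q i)) s (Zn n) (hgr n)
  have hcont : ∀ᵐ ω ∂P, Continuous (fun r : Set.Icc (0:ℝ) T => |f r.1 ω + g r.1|) := by
    filter_upwards [hconts] with ω hω
    exact ((continuousOn_iff_continuous_domRestrict.1 hω).add
      (continuousOn_iff_continuous_domRestrict.1 hg)).abs
  have hup : ∀ ω, Continuous (fun r : Set.Icc (0:ℝ) T => |f r.1 ω + g r.1|) →
      ∀ r : Set.Icc (0:ℝ) T, |f r.1 ω + g r.1| ≤ Z ω := by
    intro ω hω r
    rw [hZ]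
    exact le_ciSup (isCompact_range hω).bddAbove r
  have hbd : ∀ n, ∀ᵐ ω ∂P, |Zn n ω| ≤ Z ω := by
    intro n
    filter_upwards [hcont] with ω hω
    obtain ⟨⟨i, hi⟩, -⟩ := hgr n ω
    rw [← hi]
    simp only [abs_abs]
    exact hup ω hω _
  have hlim : ∀ᵐ ω ∂P, Filter.Tendsto (fun n => Zn n ω) Filter.atTop (nhds (Z ω)) := by
    filter_upwards [hcont] with ω hω
    refine tendsto_order.2 ⟨fun a ha => ?_, fun a ha => ?_⟩
    · rw [hZ] at ha
      obtain ⟨r, hr⟩ := exists_lt_of_lt_ciSup ha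
      obtain ⟨i, hi⟩ := hqd.exists_mem_open (isOpen_Ioi.preimage hω) ⟨r, hr⟩
      filter_upwards [Filter.eventually_ge_atTop i] with n hn
      exact lt_of_lt_of_le hi ((hgr n ω).2 ⟨⟨i, by omega⟩, rfl⟩)
    · refine .of_forall fun n => ?_
      obtain ⟨⟨i, hi⟩, -⟩ := hgr n ω
      rw [← hi]
      exact (hup ω hω _).trans_lt ha
  set m := ∫ ω', Z ω' ∂P with hm
  have hmgf : ∀ s : ℝ, _ := fun s => GaussConc.limit_level P Zn Z hZint (σ ^ 2) s
    (fun n => (hfin n s).1) (fun n => (hfin n s).2.1) (fun n => (hfin n s).2.2) hbd hlim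
  have hexp : ∀ s ω, Real.exp (s * (Z ω - m)) = Real.exp (-(s * m)) * Real.exp (s * Z ω) := by
    intro s ω
    rw [← Real.exp_add]; congr 1; ring
  have hsub : HasSubgaussianMGF (fun ω => Z ω - m) ⟨σ ^ 2, sq_nonneg σ⟩ P := by
    refine ⟨fun s => ?_, fun s => ?_⟩
    · simp only [hexp]
      exact (hmgf s).1.const_mul _
    · unfold mgf
      simp only [hexp]
      rw [integral_const_mul]
      calc _ ≤ Real.exp (-(s * m)) * Real.exp (s * m + σ ^ 2 * s ^ 2 / 2) := by
            gcongr; exact (hmgf s).2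
        _ = _ := by rw [← Real.exp_add]; congr 1; exact neg_add_cancel_left _ _
  have h1 := hsub.measure_ge_le ht
  have h2 := hsub.neg.measure_ge_le ht
  change _ ≤ Real.exp (-t ^ 2 / (2 * σ ^ 2)) at h1 h2
  have hsubset : {ω | t < |Z ω - m|} ⊆
      {ω | t ≤ Z ω - m} ∪ {ω | t ≤ (-fun ω => Z ω - m) ω} := by
    intro ω hω
    rcases lt_abs.1 (show t < |Z ω - m| from hω) with h | h
    · exact Or.inl h.le
    · exact Or.inr h.le
  calc (P {ω | t < |Z ω - m|}).toReal = P.real {ω | t < |Z ω - m|} := rfl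
    _ ≤ P.real ({ω | t ≤ Z ω - m} ∪ {ω | t ≤ (-fun ω => Z ω - m) ω}) := measureReal_mono hsubset
    _ ≤ _ := measureReal_union_le _ _
    _ ≤ _ := by rw [two_mul]; exact add_le_add h1 h2
end
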